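/- L⁶ bound on the Landau matrix of the Laplacian part (Proposition 3.1, bound (3.7)): let w₀ be a Schwartz function on ℝ³ and set w := ⟨·⟩² w₀. Then there exists a universal constant C > 0 (independent of w₀) such that ‖A[Δ(𝓜w₀)]‖_{L⁶(ℝ³)} ≤ C ‖⟨·⟩^{−3/2} ∇(𝓜w)‖_{L²(ℝ³)} + C ‖𝓜w‖_{L²(ℝ³)}. -/

import Mathlib

open MeasureTheory Set
open scoped ENNReal

noncomputable section

/-- The Japanese bracket `⟨v⟩ = (1+|v|²)^(1/2)` on `ℝ³`. -/
def jap (v : EuclideanSpace ℝ (Fin 3)) : ℝ := Real.sqrt (1 + ‖v‖ ^ 2)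

/-- Partial derivative in the `i`-th coordinate direction. -/
def pd (i : Fin 3) (φ : EuclideanSpace ℝ (Fin 3) → ℝ) (v : EuclideanSpace ℝ (Fin 3)) : ℝ :=
  fderiv ℝ φ v (EuclideanSpace.single i 1)

/-- Iterated partial derivative along a list of coordinate directions (a multi-index). -/
def pdMany : List (Fin 3) → (EuclideanSpace ℝ (Fin 3) → ℝ) → EuclideanSpace ℝ (Fin 3) → ℝ
  | [], φ => φ
  | i :: l, φ => pd i (pdMany l φ)

/-- The projection kernel `P(z) = Id − z⊗z/|z|²`. -/
def Pker (z : EuclideanSpace ℝ (Fin 3)) (i j : Fin 3) : ℝ :=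
  (if i = j then (1 : ℝ) else 0) - z i * z j / ‖z‖ ^ 2

/-- The Landau matrix `A[h](v) = (1/(8π)) ∫ (P(v−z)/|v−z|) h(z) dz` (entry `(i,j)`). -/
def LandauA (h : EuclideanSpace ℝ (Fin 3) → ℝ) (v : EuclideanSpace ℝ (Fin 3)) (i j : Fin 3) : ℝ :=
  (1 / (8 * Real.pi)) * ∫ z, Pker (v - z) i j / ‖v - z‖ * h z

/-- The Landau potential `a[h](v) = (1/(4π)) ∫ h(z)/|v−z| dz`. -/
def landaua (h : EuclideanSpace ℝ (Fin 3) → ℝ) (v : EuclideanSpace ℝ (Fin 3)) : ℝ :=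
  (1 / (4 * Real.pi)) * ∫ z, h z / ‖v - z‖

/-- The Bessel potential operator `𝓜 = (I − Δ)⁻¹` via its integral kernel. -/
def besselM (h : EuclideanSpace ℝ (Fin 3) → ℝ) (v : EuclideanSpace ℝ (Fin 3)) : ℝ :=
  (1 / (4 * Real.pi)) * ∫ z, Real.exp (-‖v - z‖) / ‖v - z‖ * h z

/-- Squared euclidean norm of the gradient. -/
def gradNormSq (φ : EuclideanSpace ℝ (Fin 3) → ℝ) (v : EuclideanSpace ℝ (Fin 3)) : ℝ :=
  ∑ i, (pd i φ v) ^ 2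

/-- Euclidean norm of the gradient. -/
def gradNorm (φ : EuclideanSpace ℝ (Fin 3) → ℝ) (v : EuclideanSpace ℝ (Fin 3)) : ℝ :=
  Real.sqrt (gradNormSq φ v)


abbrev E3 := EuclideanSpace ℝ (Fin 3)

lemma near_lint (δ : ℝ) (hδ : 0 < δ) :
    ∫⁻ z : E3, (Metric.ball (0:E3) δ).indicator (fun z => ENNReal.ofReal (1 / ‖z‖ ^ 2)) z
      = ENNReal.ofReal (3 * volume.real (Metric.ball (0:E3) 1) * δ) := by
  let f : ℝ → ℝ := (Iio δ).indicator (fun r => 1 / r ^ 2)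
  have hd : Module.finrank ℝ E3 = 3 := by simp
  have e1 : ∀ z : E3, (Metric.ball (0:E3) δ).indicator (fun z => ENNReal.ofReal (1 / ‖z‖ ^ 2)) z = ENNReal.ofReal (f ‖z‖) := by
    intro z
    by_cases h : ‖z‖ < δ <;> simp [f, h]
  have e2 : ∀ y ∈ Ioi (0:ℝ), y ^ (Module.finrank ℝ E3 - 1) • f y = (Ioo 0 δ).indicator (fun _ => (1:ℝ)) y := by
    intro y hy
    have hy : 0 < y := hy
    rw [hd]
    by_cases h : y < δ
    · simp [f, h, hy, hy.ne']
    · simp [f, h]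
  have hInt : Integrable (fun z : E3 => f ‖z‖) := by
    rw [integrable_fun_norm_addHaar volume, integrableOn_congr_fun e2 measurableSet_Ioi]
    apply Integrable.integrableOn
    rw [integrable_indicator_iff measurableSet_Ioo]
    simp
  simp_rw [e1]
  rw [← ofReal_integral_eq_lintegral_ofReal hInt]
  · rw [integral_fun_norm_addHaar volume, setIntegral_congr_fun measurableSet_Ioi e2, hd,
      setIntegral_indicator measurableSet_Ioo]
    have : Ioi (0:ℝ) ∩ Ioo 0 δ = Ioo 0 δ := by ext; simp
    rw [this]
    congr 1
    simp [hδ.le, mul_assoc]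
  · refine Filter.Eventually.of_forall fun z => ?_
    simp only [f, indicator]
    dsimp
    split_ifs <;> positivity

lemma far_lint (δ : ℝ) (hδ : 0 < δ) :
    ∫⁻ z : E3, (Metric.ball (0:E3) δ)ᶜ.indicator (fun z => ENNReal.ofReal (1 / ‖z‖ ^ 4)) z
      = ENNReal.ofReal (3 * volume.real (Metric.ball (0:E3) 1) / δ) := by
  let f : ℝ → ℝ := (Ici δ).indicator (fun r => 1 / r ^ 4)
  have hd : Module.finrank ℝ E3 = 3 := by simp
  have e1 : ∀ z : E3, (Metric.ball (0:E3) δ)ᶜ.indicator (fun z => ENNReal.ofReal (1 / ‖z‖ ^ 4)) z = ENNReal.ofReal (f ‖z‖) := by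
    intro z
    by_cases h : δ ≤ ‖z‖
    · have : z ∈ (Metric.ball (0:E3) δ)ᶜ := by simpa using h
      simp [f, h, this]
    · have : z ∉ (Metric.ball (0:E3) δ)ᶜ := by simpa using h
      simp [f, h, this]
  have e2 : ∀ y ∈ Ioi (0:ℝ), y ^ (Module.finrank ℝ E3 - 1) • f y = (Ici δ).indicator (fun r => r ^ (-2:ℝ)) y := by
    intro y hy
    have hy : 0 < y := hy
    rw [hd]
    by_cases h : δ ≤ y
    · simp only [f, mem_Ici, h, indicator_of_mem, smul_eq_mul]
      rw [Real.rpow_neg hy.le]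
      norm_cast
      field_simp
    · simp [f, h]
  have hint0 := integrableOn_Ioi_rpow_of_lt (show (-2:ℝ) < -1 by norm_num) hδ
  have hint1 : IntegrableOn (fun r : ℝ => r ^ (-2:ℝ)) (Ici δ) := by
    rwa [integrableOn_Ici_iff_integrableOn_Ioi]
  have hInt : Integrable (fun z : E3 => f ‖z‖) := by
    rw [integrable_fun_norm_addHaar volume, integrableOn_congr_fun e2 measurableSet_Ioi]
    apply Integrable.integrableOn
    rw [integrable_indicator_iff measurableSet_Ici]
    exact hint1
  simp_rw [e1]
  rw [← ofReal_integral_eq_lintegral_ofReal hInt]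
  · rw [integral_fun_norm_addHaar volume, setIntegral_congr_fun measurableSet_Ioi e2, hd,
      setIntegral_indicator measurableSet_Ici]
    have : Ioi (0:ℝ) ∩ Ici δ = Ici δ := by
      ext x; simp; intro h; linarith
    rw [this, integral_Ici_eq_integral_Ioi, integral_Ioi_rpow_of_lt (by norm_num) hδ]
    congr 1
    have : (-2:ℝ) + 1 = -1 := by norm_num
    rw [this, Real.rpow_neg_one]
    simp; field_simp
  · refine Filter.Eventually.of_forall fun z => ?_
    simp only [f, indicator]
    dsimp
    split_ifs <;> positivity

/-- The kernel `|z|⁻²`. -/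
def ker2 (z : E3) : ℝ≥0∞ := ENNReal.ofReal (1 / ‖z‖ ^ 2)

lemma ker2_meas : Measurable ker2 := by unfold ker2; fun_prop

/-- The constant `|S²|`. -/
def sphC : ℝ := 3 * volume.real (Metric.ball (0:E3) 1)

lemma sphC_pos : 0 < sphC := by
  unfold sphC
  have : 0 < volume.real (Metric.ball (0:E3) 1) := by
    rw [Measure.real]
    exact ENNReal.toReal_pos (Metric.measure_ball_pos volume _ one_pos).ne' (measure_ball_lt_top).ne
  positivity

lemma far_bound (δ N : ℝ) (hδ : 0 < δ) (hN : 0 < N) (h : E3 → ℝ≥0∞) (hm : Measurable h)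
    (hh : ∫⁻ y, h y ^ 2 ≤ ENNReal.ofReal (N ^ 2)) (x : E3) :
    ∫⁻ y, (Metric.ball (0:E3) δ)ᶜ.indicator ker2 (x - y) * h y
      ≤ ENNReal.ofReal (Real.sqrt (sphC / δ) * N) := by
  have hkm : Measurable ((Metric.ball (0:E3) δ)ᶜ.indicator ker2) :=
    ker2_meas.indicator measurableSet_ball.compl
  have h1 := ENNReal.lintegral_mul_le_Lp_mul_Lq (volume : Measure E3) (Real.HolderConjugate.two_two)
    (f := fun y => (Metric.ball (0:E3) δ)ᶜ.indicator ker2 (x - y)) (g := h)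
    (hkm.comp (measurable_const.sub measurable_id)).aemeasurable hm.aemeasurable
  refine h1.trans ?_
  have e1 : ∫⁻ y, (Metric.ball (0:E3) δ)ᶜ.indicator ker2 (x - y) ^ (2:ℝ) = ENNReal.ofReal (sphC / δ) := by
    rw [lintegral_sub_left_eq_self (fun z => (Metric.ball (0:E3) δ)ᶜ.indicator ker2 z ^ (2:ℝ)) x]
    rw [sphC, ← far_lint δ hδ]
    apply lintegral_congr
    intro z
    by_cases hz : z ∈ (Metric.ball (0:E3) δ)ᶜ
    · rw [indicator_of_mem hz, indicator_of_mem hz, ker2, ENNReal.rpow_two, ← ENNReal.ofReal_pow (by positivity)]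
      congr 1
      rw [div_pow, ← pow_mul]; simp
    · rw [indicator_of_notMem hz, indicator_of_notMem hz]; simp
  rw [e1]
  have e2 : (∫⁻ y, h y ^ (2:ℝ)) ≤ ENNReal.ofReal (N ^ 2) := by simpa using hh
  calc _ ≤ ENNReal.ofReal (sphC / δ) ^ (1 / 2 : ℝ) * ENNReal.ofReal (N ^ 2) ^ (1 / 2 : ℝ) := by gcongr
    _ = _ := by
      have hs := sphC_pos
      rw [ENNReal.ofReal_rpow_of_nonneg (by positivity) (by norm_num),
        ENNReal.ofReal_rpow_of_nonneg (by positivity) (by norm_num),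
        ← ENNReal.ofReal_mul (by positivity), ← Real.sqrt_eq_rpow, ← Real.sqrt_eq_rpow,
        Real.sqrt_sq hN.le]

lemma near_bound (δ a : ℝ) (hδ : 0 < δ) (h : E3 → ℝ≥0∞)
    (hh : ∀ y, h y ≤ ENNReal.ofReal a) (x : E3) :
    ∫⁻ y, (Metric.ball (0:E3) δ).indicator ker2 (x - y) * h y
      ≤ ENNReal.ofReal (sphC * δ * a) := by
  have hkm : Measurable ((Metric.ball (0:E3) δ).indicator ker2) :=
    ker2_meas.indicator measurableSet_ball
  calc _ ≤ ∫⁻ y, (Metric.ball (0:E3) δ).indicator ker2 (x - y) * ENNReal.ofReal a := by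
        gcongr; exact hh _
    _ = (∫⁻ y, (Metric.ball (0:E3) δ).indicator ker2 (x - y)) * ENNReal.ofReal a := by
        rw [lintegral_mul_const]
        exact hkm.comp (measurable_const.sub measurable_id)
    _ = _ := by
        rw [lintegral_sub_left_eq_self (fun z => (Metric.ball (0:E3) δ).indicator ker2 z) x]
        have := near_lint δ hδ
        unfold ker2
        rw [this, ← ENNReal.ofReal_mul (by have := sphC_pos; unfold sphC at this; positivity)]
        rfl

lemma near_L1 (δ : ℝ) (hδ : 0 < δ) (h : E3 → ℝ≥0∞) (hm : Measurable h) :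
    ∫⁻ x, ∫⁻ y, (Metric.ball (0:E3) δ).indicator ker2 (x - y) * h y
      = ENNReal.ofReal (sphC * δ) * ∫⁻ y, h y := by
  have hkm : Measurable ((Metric.ball (0:E3) δ).indicator ker2) :=
    ker2_meas.indicator measurableSet_ball
  rw [lintegral_lintegral_swap]
  · have : ∀ y, ∫⁻ x, (Metric.ball (0:E3) δ).indicator ker2 (x - y) * h y = ENNReal.ofReal (sphC * δ) * h y := by
      intro y
      have hk2 : Measurable fun x => (Metric.ball (0:E3) δ).indicator ker2 (x - y) :=
        hkm.comp (measurable_id.sub_const y)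
      rw [lintegral_mul_const _ hk2,
        lintegral_sub_right_eq_self (fun z => (Metric.ball (0:E3) δ).indicator ker2 z) y]
      have := near_lint δ hδ
      unfold ker2
      rw [this]; rfl
    simp_rw [this]
    rw [lintegral_const_mul _ hm]
  · apply Measurable.aemeasurable
    exact (hkm.comp (measurable_fst.sub measurable_snd)).mul (hm.comp measurable_snd)

lemma T_meas (h : E3 → ℝ≥0∞) (hm : Measurable h) : Measurable fun x => ∫⁻ y, ker2 (x - y) * h y := by
  apply Measurable.lintegral_prod_right'
    (f := fun p : E3 × E3 => ker2 (p.1 - p.2) * h p.2)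
  exact (ker2_meas.comp (measurable_fst.sub measurable_snd)).mul (hm.comp measurable_snd)

lemma level_bound (N : ℝ) (hN : 0 < N) (h : E3 → ℝ) (hm : Measurable h)
    (hh : ∫⁻ y, ENNReal.ofReal (h y) ^ 2 ≤ ENNReal.ofReal (N ^ 2)) (t : ℝ) (ht : 0 < t) :
    volume {x : E3 | ENNReal.ofReal t < ∫⁻ y, ker2 (x - y) * ENNReal.ofReal (h y)}
      ≤ ENNReal.ofReal (16 * sphC ^ 2 * N ^ 2 / t ^ 3) *
        ∫⁻ y, {y | t ^ 3 < 16 * sphC ^ 2 * N ^ 2 * h y}.indicator (fun y => ENNReal.ofReal (h y)) y := by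
  have hs := sphC_pos
  set b := 16 * sphC ^ 2 * N ^ 2 with hb
  have hbp : 0 < b := by positivity
  set δ := 4 * sphC * N ^ 2 / t ^ 2 with hδ
  have hδp : 0 < δ := by positivity
  set A := {y | t ^ 3 < b * h y} with hA
  have hAm : MeasurableSet A := measurableSet_lt measurable_const (hm.const_mul b)
  set hi : E3 → ℝ≥0∞ := A.indicator (fun y => ENNReal.ofReal (h y)) with hhi
  set lo : E3 → ℝ≥0∞ := Aᶜ.indicator (fun y => ENNReal.ofReal (h y)) with hlo
  have hhm : Measurable (fun y => ENNReal.ofReal (h y)) := hm.ennreal_ofReal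
  have him : Measurable hi := hhm.indicator hAm
  have hlm : Measurable lo := hhm.indicator hAm.compl
  have hkn : Measurable ((Metric.ball (0:E3) δ).indicator ker2) :=
    ker2_meas.indicator measurableSet_ball
  have hkf : Measurable ((Metric.ball (0:E3) δ)ᶜ.indicator ker2) :=
    ker2_meas.indicator measurableSet_ball.compl
  have hsplit : ∀ x, ∫⁻ y, ker2 (x - y) * ENNReal.ofReal (h y) =
      (∫⁻ y, (Metric.ball (0:E3) δ)ᶜ.indicator ker2 (x - y) * ENNReal.ofReal (h y)) +
      ((∫⁻ y, (Metric.ball (0:E3) δ).indicator ker2 (x - y) * lo y) +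
      ∫⁻ y, (Metric.ball (0:E3) δ).indicator ker2 (x - y) * hi y) := by
    intro x
    have hsub : Measurable (fun y : E3 => x - y) := measurable_const.sub measurable_id
    have m1 : Measurable fun y => (Metric.ball (0:E3) δ).indicator ker2 (x - y) * lo y := (hkn.comp hsub).mul hlm
    have m2 : Measurable fun y => (Metric.ball (0:E3) δ)ᶜ.indicator ker2 (x - y) * ENNReal.ofReal (h y) := (hkf.comp hsub).mul hhm
    rw [← lintegral_add_left m1, ← lintegral_add_left m2]
    apply lintegral_congr
    intro y
    have e1 : ENNReal.ofReal (h y) = lo y + hi y := by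
      by_cases hy : y ∈ A <;> simp [hlo, hhi, hy]
    have e2 : ker2 (x - y) = (Metric.ball (0:E3) δ)ᶜ.indicator ker2 (x - y) + (Metric.ball (0:E3) δ).indicator ker2 (x - y) :=
      (congrFun (indicator_compl_add_self (Metric.ball (0:E3) δ) ker2) (x - y)).symm
    rw [← mul_add, ← e1, ← add_mul, ← e2]
  have hfar : ∀ x, (∫⁻ y, (Metric.ball (0:E3) δ)ᶜ.indicator ker2 (x - y) * ENNReal.ofReal (h y)) ≤ ENNReal.ofReal (t / 2) := by
    intro x
    refine (far_bound δ N hδp hN _ hhm hh x).trans (ENNReal.ofReal_le_ofReal (le_of_eq ?_))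
    have : sphC / δ = (t / (2 * N)) ^ 2 := by rw [hδ]; field_simp; ring
    rw [this, Real.sqrt_sq (by positivity)]
    field_simp
  have hnl : ∀ x, (∫⁻ y, (Metric.ball (0:E3) δ).indicator ker2 (x - y) * lo y) ≤ ENNReal.ofReal (t / 4) := by
    intro x
    refine (near_bound δ (t ^ 3 / b) hδp lo ?_ x).trans (ENNReal.ofReal_le_ofReal (le_of_eq ?_))
    · intro y
      by_cases hy : y ∈ A
      · simp [hlo, hy]
      · have : h y ≤ t ^ 3 / b := by
          rw [le_div_iff₀ hbp]
          have : ¬ (t ^ 3 < b * h y) := hy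
          linarith
        simp only [hlo, mem_compl_iff, hy, not_false_eq_true, indicator_of_mem]
        exact ENNReal.ofReal_le_ofReal this
    · rw [hδ, hb]; field_simp; norm_num
  have hsubset : {x : E3 | ENNReal.ofReal t < ∫⁻ y, ker2 (x - y) * ENNReal.ofReal (h y)} ⊆
      {x | ENNReal.ofReal (t / 4) ≤ ∫⁻ y, (Metric.ball (0:E3) δ).indicator ker2 (x - y) * hi y} := by
    intro x hx
    have hx : ENNReal.ofReal t < ∫⁻ y, ker2 (x - y) * ENNReal.ofReal (h y) := hx
    by_contra hc
    have hc : (∫⁻ y, (Metric.ball (0:E3) δ).indicator ker2 (x - y) * hi y) ≤ ENNReal.ofReal (t / 4) := le_of_lt (not_le.mp hc)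
    rw [hsplit x] at hx
    have := add_le_add (hfar x) (add_le_add (hnl x) hc)
    rw [← ENNReal.ofReal_add (by positivity) (by positivity), ← ENNReal.ofReal_add (by positivity) (by positivity)] at this
    have e : t / 2 + (t / 4 + t / 4) = t := by ring
    rw [e] at this
    exact absurd hx (not_lt.mpr this)
  refine (measure_mono hsubset).trans ?_
  have hmm : Measurable fun x => ∫⁻ y, (Metric.ball (0:E3) δ).indicator ker2 (x - y) * hi y := by
    apply Measurable.lintegral_prod_right'
      (f := fun p : E3 × E3 => (Metric.ball (0:E3) δ).indicator ker2 (p.1 - p.2) * hi p.2)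
    exact (hkn.comp (measurable_fst.sub measurable_snd)).mul (him.comp measurable_snd)
  refine (meas_ge_le_lintegral_div hmm.aemeasurable (by simpa using ht) ENNReal.ofReal_ne_top).trans ?_
  rw [near_L1 δ hδp hi him, ENNReal.div_eq_inv_mul, ← mul_assoc, ← ENNReal.ofReal_inv_of_pos (by positivity), ← ENNReal.ofReal_mul (by positivity)]
  gcongr
  apply le_of_eq
  rw [hδ, hb]; field_simp; norm_num

lemma T_fin (N B : ℝ) (hN : 0 < N) (h : E3 → ℝ) (hm : Measurable h) (hB : ∀ y, h y ≤ B)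
    (hh : ∫⁻ y, ENNReal.ofReal (h y) ^ 2 ≤ ENNReal.ofReal (N ^ 2)) (x : E3) :
    ∫⁻ y, ker2 (x - y) * ENNReal.ofReal (h y) ≠ ∞ := by
  have h1 := far_bound 1 N one_pos hN _ hm.ennreal_ofReal hh x
  have h2 := near_bound 1 B one_pos (fun y => ENNReal.ofReal (h y)) (fun y => ENNReal.ofReal_le_ofReal (hB y)) x
  have hsub : Measurable (fun y : E3 => x - y) := measurable_const.sub measurable_id
  have hkf : Measurable ((Metric.ball (0:E3) 1)ᶜ.indicator ker2) :=
    ker2_meas.indicator measurableSet_ball.compl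
  have e : ∫⁻ y, ker2 (x - y) * ENNReal.ofReal (h y) =
      (∫⁻ y, (Metric.ball (0:E3) 1)ᶜ.indicator ker2 (x - y) * ENNReal.ofReal (h y)) +
      (∫⁻ y, (Metric.ball (0:E3) 1).indicator ker2 (x - y) * ENNReal.ofReal (h y)) := by
    have m2 : Measurable fun y => (Metric.ball (0:E3) 1)ᶜ.indicator ker2 (x - y) * ENNReal.ofReal (h y) := (hkf.comp hsub).mul hm.ennreal_ofReal
    rw [← lintegral_add_left m2]
    apply lintegral_congr
    intro y
    rw [← add_mul]
    congr 1
    exact (congrFun (indicator_compl_add_self (Metric.ball (0:E3) 1) ker2) (x - y)).symm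
  rw [e]
  exact (ENNReal.add_lt_top.mpr ⟨h1.trans_lt ENNReal.ofReal_lt_top, h2.trans_lt ENNReal.ofReal_lt_top⟩).ne

lemma cube_lint (X : ℝ) :
    ∫⁻ t in Ioi (0:ℝ), {t : ℝ | t ^ 3 < X}.indicator (fun t => ENNReal.ofReal (t ^ 2)) t ≤ ENNReal.ofReal X := by
  by_cases hX : X ≤ 0
  · refine le_trans (le_of_eq ?_) zero_le
    rw [← lintegral_zero]
    apply setLIntegral_congr_fun measurableSet_Ioi
    intro t ht
    have ht : 0 < t := ht
    have : ¬ t ^ 3 < X := by have : 0 < t ^ 3 := by positivity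
                             linarith
    simp [this]
  push Not at hX
  set r := X ^ (1 / 3 : ℝ) with hr
  have hr0 : 0 < r := by positivity
  have hr3 : r ^ 3 = X := by
    rw [hr, ← Real.rpow_natCast, ← Real.rpow_mul hX.le]; norm_num
  calc _ ≤ ∫⁻ t in Ioi (0:ℝ), (Ioo 0 r).indicator (fun t => ENNReal.ofReal (r ^ 2)) t := by
        apply setLIntegral_mono' measurableSet_Ioi
        intro t ht
        have ht : 0 < t := ht
        by_cases h : t ^ 3 < X
        · have h3 : t < r := by
            rw [← hr3] at h
            exact lt_of_pow_lt_pow_left₀ 3 hr0.le h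
          simp only [mem_ofPred_eq, h, indicator_of_mem, mem_Ioo, ht, h3, and_self]
          gcongr
        · simp [h]
    _ ≤ ∫⁻ t, (Ioo 0 r).indicator (fun t => ENNReal.ofReal (r ^ 2)) t := setLIntegral_le_lintegral _ _
    _ = _ := by
        rw [lintegral_indicator measurableSet_Ioo]
        simp
        rw [← ENNReal.ofReal_mul (by positivity), ← hr3]
        ring_nf

lemma hls_N (N B : ℝ) (hN : 0 < N) (h : E3 → ℝ) (hm : Measurable h) (h0 : ∀ y, 0 ≤ h y) (hB : ∀ y, h y ≤ B)
    (hh : ∫⁻ y, ENNReal.ofReal (h y) ^ 2 ≤ ENNReal.ofReal (N ^ 2)) :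
    ∫⁻ x, (∫⁻ y, ker2 (x - y) * ENNReal.ofReal (h y)) ^ 6 ≤ ENNReal.ofReal (6 * 256 * sphC ^ 4 * N ^ 6) := by
  have hs := sphC_pos
  set b := 16 * sphC ^ 2 * N ^ 2 with hb
  have hbp : 0 < b := by positivity
  have hfin := T_fin N B hN h hm hB hh
  set u : E3 → ℝ := fun x => (∫⁻ y, ker2 (x - y) * ENNReal.ofReal (h y)).toReal with hu
  have hum : Measurable u := (T_meas _ hm.ennreal_ofReal).ennreal_toReal
  have hu0 : ∀ x, 0 ≤ u x := fun x => ENNReal.toReal_nonneg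
  have hTu : ∀ x, ∫⁻ y, ker2 (x - y) * ENNReal.ofReal (h y) = ENNReal.ofReal (u x) :=
    fun x => (ENNReal.ofReal_toReal (hfin x)).symm
  have e1 : ∫⁻ x, (∫⁻ y, ker2 (x - y) * ENNReal.ofReal (h y)) ^ 6 = ∫⁻ x, ENNReal.ofReal (u x ^ (6:ℝ)) := by
    apply lintegral_congr
    intro x
    rw [hTu, ← ENNReal.ofReal_pow (hu0 x)]
    norm_cast
  rw [e1, lintegral_rpow_eq_lintegral_meas_lt_mul volume (Filter.Eventually.of_forall hu0) hum.aemeasurable (by norm_num)]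
  have hlev : ∀ t ∈ Ioi (0:ℝ), volume {a | t < u a} * ENNReal.ofReal (t ^ ((6:ℝ) - 1)) ≤
      ENNReal.ofReal b * ∫⁻ y, {p : ℝ × E3 | p.1 ^ 3 < b * h p.2}.indicator (fun p => ENNReal.ofReal (p.1 ^ 2) * ENNReal.ofReal (h p.2)) (t, y) := by
    intro t ht
    have ht : 0 < t := ht
    have h1 := level_bound N hN h hm hh t ht
    have h2 : {a | t < u a} = {x : E3 | ENNReal.ofReal t < ∫⁻ y, ker2 (x - y) * ENNReal.ofReal (h y)} := by
      ext x
      simp only [mem_ofPred_eq, hTu]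
      exact (ENNReal.ofReal_lt_ofReal_iff_of_nonneg ht.le).symm
    rw [h2]
    have h3 : t ^ ((6:ℝ) - 1) = t ^ 5 := by norm_num
    rw [h3]
    refine (mul_le_mul_left h1 _).trans (le_of_eq ?_)
    rw [← hb, mul_right_comm, ← ENNReal.ofReal_mul (by positivity)]
    have h4 : b / t ^ 3 * t ^ 5 = b * t ^ 2 := by field_simp
    rw [h4, ENNReal.ofReal_mul hbp.le, mul_assoc]
    congr 1
    have hAm : MeasurableSet {y | t ^ 3 < b * h y} := measurableSet_lt measurable_const (hm.const_mul b)
    rw [← lintegral_const_mul _ (hm.ennreal_ofReal.indicator hAm)]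
    apply lintegral_congr
    intro y
    by_cases hy : t ^ 3 < b * h y <;> simp [hy]
  have hPm : Measurable (Function.uncurry fun (t : ℝ) (y : E3) => {p : ℝ × E3 | p.1 ^ 3 < b * h p.2}.indicator (fun p => ENNReal.ofReal (p.1 ^ 2) * ENNReal.ofReal (h p.2)) (t, y)) := by
    have : MeasurableSet {p : ℝ × E3 | p.1 ^ 3 < b * h p.2} :=
      measurableSet_lt (measurable_fst.pow_const 3) ((hm.comp measurable_snd).const_mul b)
    refine Measurable.indicator ?_ this
    exact (measurable_fst.pow_const 2).ennreal_ofReal.mul (hm.comp measurable_snd).ennreal_ofReal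
  calc _ ≤ ENNReal.ofReal 6 * ∫⁻ t in Ioi (0:ℝ), ENNReal.ofReal b * ∫⁻ y, {p : ℝ × E3 | p.1 ^ 3 < b * h p.2}.indicator (fun p => ENNReal.ofReal (p.1 ^ 2) * ENNReal.ofReal (h p.2)) (t, y) := by
        refine mul_le_mul_right ?_ _
        exact setLIntegral_mono' measurableSet_Ioi hlev
    _ = ENNReal.ofReal 6 * (ENNReal.ofReal b * ∫⁻ y, ∫⁻ t in Ioi (0:ℝ), {p : ℝ × E3 | p.1 ^ 3 < b * h p.2}.indicator (fun p => ENNReal.ofReal (p.1 ^ 2) * ENNReal.ofReal (h p.2)) (t, y)) := by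
        have m3 := hPm.lintegral_prod_right' (ν := (volume : Measure E3))
        simp only [Function.uncurry_apply_pair] at m3
        rw [lintegral_const_mul _ m3, lintegral_lintegral_swap hPm.aemeasurable]
    _ ≤ ENNReal.ofReal 6 * (ENNReal.ofReal b * ∫⁻ y, ENNReal.ofReal b * ENNReal.ofReal (h y) ^ 2) := by
        gcongr with y
        calc _ = ∫⁻ t in Ioi (0:ℝ), {t : ℝ | t ^ 3 < b * h y}.indicator (fun t => ENNReal.ofReal (t ^ 2)) t * ENNReal.ofReal (h y) := by
              apply lintegral_congr
              intro t
              by_cases hy : t ^ 3 < b * h y <;> simp [hy]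
          _ = (∫⁻ t in Ioi (0:ℝ), {t : ℝ | t ^ 3 < b * h y}.indicator (fun t => ENNReal.ofReal (t ^ 2)) t) * ENNReal.ofReal (h y) := by
              rw [lintegral_mul_const]
              exact (measurable_id.pow_const 2).ennreal_ofReal.indicator (measurableSet_lt (measurable_id.pow_const 3) measurable_const)
          _ ≤ ENNReal.ofReal (b * h y) * ENNReal.ofReal (h y) := by
              gcongr; exact cube_lint _
          _ = _ := by rw [ENNReal.ofReal_mul hbp.le]; ring
    _ ≤ ENNReal.ofReal 6 * (ENNReal.ofReal b * (ENNReal.ofReal b * ENNReal.ofReal (N ^ 2))) := by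
        rw [lintegral_const_mul _ (hm.ennreal_ofReal.pow_const 2)]
        gcongr
    _ = _ := by
        rw [← ENNReal.ofReal_mul (by positivity), ← ENNReal.ofReal_mul (by positivity), ← ENNReal.ofReal_mul (by positivity)]
        congr 1; rw [hb]; ring

lemma hls (B : ℝ) (h : E3 → ℝ) (hm : Measurable h) (h0 : ∀ y, 0 ≤ h y) (hB : ∀ y, h y ≤ B)
    (N : ℝ) (hN : 0 ≤ N) (hh : ∫⁻ y, ENNReal.ofReal (h y) ^ 2 ≤ ENNReal.ofReal (N ^ 2)) :
    ∫⁻ x, (∫⁻ y, ker2 (x - y) * ENNReal.ofReal (h y)) ^ 6 ≤ ENNReal.ofReal (6 * 256 * sphC ^ 4 * N ^ 6) := by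
  rcases hN.lt_or_eq with hN | rfl
  · exact hls_N N B hN h hm h0 hB hh
  · have hz : ∫⁻ y, ENNReal.ofReal (h y) ^ 2 = 0 := by simpa using hh
    rw [lintegral_eq_zero_iff (hm.ennreal_ofReal.pow_const 2)] at hz
    have : ∀ x, ∫⁻ y, ker2 (x - y) * ENNReal.ofReal (h y) = 0 := by
      intro x
      rw [← lintegral_zero (μ := (volume : Measure E3))]
      apply lintegral_congr_ae
      filter_upwards [hz] with y hy
      have : ENNReal.ofReal (h y) = 0 := by simpa using hy
      rw [this, mul_zero]
    simp [this]
open scoped SchwartzMap LineDeriv Laplacian in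
lemma bessel_exists (w : SchwartzMap E3 ℝ) : ∃ f : SchwartzMap E3 ℝ,
    ∀ x, f x - ∑ m, pd m (pd m f) x = w x := by
  let wc : SchwartzMap E3 ℂ := w.postcompCLM Complex.ofRealCLM
  let s : E3 → ℝ := fun ξ => (1 + ‖(2 * Real.pi) • ξ‖ ^ 2) ^ (-1 : ℝ)
  have hs : s.HasTemperateGrowth := by
    have h1 := Function.hasTemperateGrowth_one_add_norm_sq_rpow E3 (-1)
    have h2 : (fun ξ : E3 => (2 * Real.pi) • ξ).HasTemperateGrowth := by fun_prop
    exact h1.comp h2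
  let g : SchwartzMap E3 ℂ := SchwartzMap.fourierMultiplierCLM ℂ s wc
  have hg : g - Δ g = wc := by
    rw [SchwartzMap.laplacian_eq_fourierMultiplierCLM]
    have h3 : SchwartzMap.fourierMultiplierCLM ℂ ((fun x : E3 => ‖x‖ ^ 2) : E3 → ℝ) g = SchwartzMap.fourierMultiplierCLM ℂ ((fun x : E3 => ‖x‖ ^ 2) * s) wc := by
      rw [SchwartzMap.fourierMultiplierCLM_fourierMultiplierCLM_apply (by fun_prop) hs]
    have h0 : SchwartzMap.fourierMultiplierCLM ℂ (fun _ : E3 => (1 : ℝ)) wc = wc := by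
      rw [SchwartzMap.fourierMultiplierCLM_const]; simp
    conv_rhs => rw [← h0]
    have h4 : (fun _ : E3 => (1 : ℝ)) = fun ξ => ∑ i : Fin 2, (![s, ((2 * Real.pi) ^ 2) • ((fun x : E3 => ‖x‖ ^ 2) * s)] i) ξ := by
      funext ξ
      simp only [Fin.sum_univ_two, Matrix.cons_val_zero, Matrix.cons_val_one, Pi.smul_apply, Pi.mul_apply, s, smul_eq_mul, norm_smul, mul_pow, Real.norm_eq_abs, sq_abs, Real.rpow_neg_one]
      have : (0:ℝ) < 1 + 2 ^ 2 * Real.pi ^ 2 * ‖ξ‖ ^ 2 := by positivity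
      field_simp
    have h5 : ((fun x : E3 => ‖x‖ ^ 2) * s).HasTemperateGrowth := by
      have : (fun x : E3 => ‖x‖ ^ 2).HasTemperateGrowth := by fun_prop
      exact this.mul hs
    rw [h4, SchwartzMap.fourierMultiplierCLM_sum]
    · simp only [Fin.sum_univ_two, Matrix.cons_val_zero, Matrix.cons_val_one]
      rw [SchwartzMap.fourierMultiplierCLM_smul (F := ℂ) h5]
      have h6 : SchwartzMap.fourierMultiplierCLM ℂ (fun x : E3 => ‖x‖ ^ 2) g = SchwartzMap.fourierMultiplierCLM ℂ ((fun x : E3 => ‖x‖ ^ 2) * s) wc := h3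
      rw [h6]
      ext x
      simp [g]
    · intro i _
      fin_cases i
      · exact hs
      · change (((2 * Real.pi) ^ 2) • ((fun x : E3 => ‖x‖ ^ 2) * s)).HasTemperateGrowth
        have := (Function.HasTemperateGrowth.const (E := E3) ((2 * Real.pi) ^ 2)).mul h5
        exact this
  let f : SchwartzMap E3 ℝ := g.postcompCLM Complex.reCLM
  have hpd : ∀ (m : Fin 3) (φ : SchwartzMap E3 ℂ), pd m (φ.postcompCLM Complex.reCLM) = ⇑(SchwartzMap.postcompCLM Complex.reCLM (∂_{EuclideanSpace.single m (1:ℝ)} φ : SchwartzMap E3 ℂ)) := by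
    intro m φ
    funext x
    simp only [pd, SchwartzMap.postcompCLM_apply, SchwartzMap.lineDerivOp_apply_eq_fderiv]
    have := (Complex.reCLM.hasFDerivAt (x := φ x)).comp x (φ.hasFDerivAt x)
    have h2 : fderiv ℝ (⇑(φ.postcompCLM Complex.reCLM)) x = _ := this.fderiv
    rw [h2]; rfl
  refine ⟨f, fun x => ?_⟩
  have h1 : (g - Δ g) x = wc x := by rw [hg]
  have h2 := congrArg Complex.re h1
  rw [SchwartzMap.laplacian_eq_sum (EuclideanSpace.basisFun (Fin 3) ℝ)] at h2
  simp only [f, hpd]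
  simp only [EuclideanSpace.basisFun_apply, sub_apply, sum_apply, Complex.sub_re, Complex.re_sum, wc, SchwartzMap.postcompCLM_apply] at h2
  simpa using h2

open scoped SchwartzMap LineDeriv in
/-- The partial derivative of a Schwartz function, as a Schwartz function. -/
def Ds (m : Fin 3) (f : SchwartzMap E3 ℝ) : SchwartzMap E3 ℝ := ∂_{EuclideanSpace.single m (1:ℝ)} f

lemma pd_eq (m : Fin 3) (f : SchwartzMap E3 ℝ) : pd m f = ⇑(Ds m f) := by
  funext x
  simp only [pd, Ds, SchwartzMap.lineDerivOp_apply_eq_fderiv]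

lemma Ds_ibp (m : Fin 3) (f g : SchwartzMap E3 ℝ) :
    ∫ x, f x * Ds m g x = - ∫ x, Ds m f x * g x :=
  SchwartzMap.integral_mul_lineDerivOp_right_eq_neg_left f g _

lemma int_mul (f g : SchwartzMap E3 ℝ) : Integrable fun x => f x * g x :=
  (f.memLp 2).integrable_mul (g.memLp 2)

lemma int_sq (f : SchwartzMap E3 ℝ) : Integrable fun x => f x ^ 2 := by
  simpa [sq] using int_mul f f

lemma jap_sq (x : E3) : jap x ^ 2 = 1 + ‖x‖ ^ 2 := by
  unfold jap; rw [Real.sq_sqrt (by positivity)]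

lemma jap_ge (x : E3) : 1 ≤ jap x := by
  unfold jap; rw [Real.one_le_sqrt]; nlinarith [sq_nonneg ‖x‖]

lemma coord_sq_le (x : E3) (m : Fin 3) : (x m) ^ 2 ≤ ‖x‖ ^ 2 := by
  rw [EuclideanSpace.norm_sq_eq]
  have := Finset.single_le_sum (f := fun i => ‖x i‖ ^ 2) (fun i _ => sq_nonneg _) (Finset.mem_univ m)
  simpa using this

lemma hasLine_nsq (z : E3) (m : Fin 3) :
    HasDerivAt (fun t : ℝ => ‖z + t • (EuclideanSpace.single m (1:ℝ) : E3)‖ ^ 2) (2 * z m) 0 := by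
  have e : (fun t : ℝ => ‖z + t • (EuclideanSpace.single m (1:ℝ) : E3)‖ ^ 2) = fun t => ‖z‖ ^ 2 + 2 * z m * t + t ^ 2 := by
    funext t
    rw [norm_add_sq_real, norm_smul, inner_smul_right]
    simp [EuclideanSpace.inner_single_right]; ring
  rw [e]
  have := (((hasDerivAt_id (0:ℝ)).const_mul (2 * z m)).const_add (‖z‖ ^ 2)).add ((hasDerivAt_id (0:ℝ)).pow 2)
  convert! this using 1
  simp

/-- The weighted function `⟨v⟩⁻² f`. -/
def wt (f : SchwartzMap E3 ℝ) : SchwartzMap E3 ℝ :=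
  SchwartzMap.smulLeftCLM ℝ (fun x : E3 => (1 + ‖x‖ ^ 2) ^ (-1 : ℝ)) f

lemma wt_apply (f : SchwartzMap E3 ℝ) (x : E3) : wt f x = (1 + ‖x‖ ^ 2)⁻¹ * f x := by
  unfold wt
  rw [SchwartzMap.smulLeftCLM_apply_apply (by fun_prop), Real.rpow_neg_one, smul_eq_mul]

lemma Ds_line (m : Fin 3) (f : SchwartzMap E3 ℝ) (x : E3) :
    HasLineDerivAt ℝ f (Ds m f x) x (EuclideanSpace.single m (1:ℝ)) := by
  have := (f.hasFDerivAt x).hasLineDerivAt (EuclideanSpace.single m (1:ℝ))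
  rw [← pd_eq]; exact this

lemma Ds_wt (m : Fin 3) (f : SchwartzMap E3 ℝ) (x : E3) :
    Ds m (wt f) x = (1 + ‖x‖ ^ 2)⁻¹ * Ds m f x - 2 * x m * ((1 + ‖x‖ ^ 2)⁻¹) ^ 2 * f x := by
  have h1 := Ds_line m (wt f) x
  have h2 : HasLineDerivAt ℝ (wt f) ((1 + ‖x‖ ^ 2)⁻¹ * Ds m f x - 2 * x m * ((1 + ‖x‖ ^ 2)⁻¹) ^ 2 * f x) x (EuclideanSpace.single m (1:ℝ)) := by
    have a1 : HasDerivAt (fun t : ℝ => f (x + t • (EuclideanSpace.single m (1:ℝ) : E3))) (Ds m f x) 0 := Ds_line m f x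
    have a2 := ((hasLine_nsq x m).const_add 1).inv (by positivity)
    have a3 := a2.mul a1
    unfold HasLineDerivAt
    have e : (fun t : ℝ => wt f (x + t • (EuclideanSpace.single m (1:ℝ) : E3))) = fun t => (1 + ‖x + t • (EuclideanSpace.single m (1:ℝ) : E3)‖ ^ 2)⁻¹ * f (x + t • (EuclideanSpace.single m (1:ℝ) : E3)) := by
      funext t; rw [wt_apply]
    rw [e]
    convert! a3 using 1
    simp
    field_simp
    ring
  exact h1.unique h2

lemma japw (x : E3) : (jap x ^ (-(3 : ℝ) / 2)) ^ 2 = jap x ^ (-3 : ℝ) := by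
  have := jap_ge x
  rw [← Real.rpow_natCast, ← Real.rpow_mul (by linarith)]; norm_num

lemma energy (f F : SchwartzMap E3 ℝ)
    (h : ∀ x, f x - ∑ m, pd m (pd m f) x = (jap x ^ 2)⁻¹ * (F x - ∑ m, pd m (pd m F) x)) :
    Integrable (fun x => (jap x ^ (-(3 : ℝ) / 2)) ^ 2 * ∑ m, (Ds m F x) ^ 2) ∧
    ∫ x, ∑ m, (Ds m f x) ^ 2 ≤ 18 * ((∫ x, F x ^ 2) +
      ∫ x, (jap x ^ (-(3 : ℝ) / 2)) ^ 2 * ∑ m, (Ds m F x) ^ 2) := by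
  have hjc : Continuous fun x : E3 => (jap x ^ (-(3 : ℝ) / 2)) ^ 2 := by
    simp_rw [japw]
    have : Continuous jap := by unfold jap; fun_prop
    exact this.rpow_const (fun x => Or.inl (by have := jap_ge x; linarith))
  have hj1 : ∀ x : E3, (jap x ^ (-(3 : ℝ) / 2)) ^ 2 ≤ 1 := by
    intro x
    rw [japw]
    exact Real.rpow_le_one_of_one_le_of_nonpos (jap_ge x) (by norm_num)
  have hDsum : ∀ g : SchwartzMap E3 ℝ, Integrable fun x => ∑ m, (Ds m g x) ^ 2 :=
    fun g => integrable_finsetSum _ fun m _ => int_sq _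
  have hI : Integrable (fun x => (jap x ^ (-(3 : ℝ) / 2)) ^ 2 * ∑ m, (Ds m F x) ^ 2) := by
    refine (hDsum F).bdd_mul (c := 1) hjc.aestronglyMeasurable (Filter.Eventually.of_forall fun x => ?_)
    rw [Real.norm_eq_abs, abs_of_nonneg (by positivity)]
    exact hj1 x
  refine ⟨hI, ?_⟩
  -- the energy identity
  have key : ∀ g G : SchwartzMap E3 ℝ, ∫ x, g x * (G x - ∑ m, Ds m (Ds m G) x) =
      ∫ x, (g x * G x + ∑ m, Ds m g x * Ds m G x) := by
    intro g G
    have e1 : ∀ x, g x * (G x - ∑ m, Ds m (Ds m G) x) = g x * G x - ∑ m, g x * Ds m (Ds m G) x := by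
      intro x; rw [mul_sub, Finset.mul_sum]
    simp_rw [e1]
    rw [integral_sub (int_mul _ _) (integrable_finsetSum _ fun m _ => int_mul _ _),
      integral_add (int_mul _ _) (integrable_finsetSum _ fun m _ => int_mul _ _),
      integral_finsetSum _ (fun m _ => int_mul _ _), integral_finsetSum _ (fun m _ => int_mul _ _)]
    simp_rw [Ds_ibp]
    simp
    ring
  have k1 := key f f
  have k2 := key (wt f) F
  have k3 : ∫ x, f x * (f x - ∑ m, Ds m (Ds m f) x) = ∫ x, wt f x * (F x - ∑ m, Ds m (Ds m F) x) := by
    congr 1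
    funext x
    have := h x
    simp only [pd_eq] at this
    rw [this, wt_apply, jap_sq]; ring
  have k4 : ∫ x, (wt f x * F x + ∑ m, Ds m (wt f) x * Ds m F x) ≤
      ∫ x, ((1/2) * (f x ^ 2 + ∑ m, Ds m f x ^ 2) + 9 * (F x ^ 2 + (jap x ^ (-(3 : ℝ) / 2)) ^ 2 * ∑ m, (Ds m F x) ^ 2)) := by
    apply integral_mono
    · exact (int_mul _ _).add (integrable_finsetSum _ fun m _ => int_mul _ _)
    · exact (((int_sq f).add (hDsum f)).const_mul _).add (((int_sq F).add hI).const_mul _)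
    · intro x
      simp only [Ds_wt, wt_apply]
      set q := (1 + ‖x‖ ^ 2)⁻¹ with hq
      have hq0 : 0 < q := by positivity
      have hq1 : q ≤ 1 := by
        rw [hq]; apply inv_le_one_of_one_le₀; nlinarith [sq_nonneg ‖x‖]
      have hqx : q * ‖x‖ ^ 2 ≤ 1 := by
        rw [hq, inv_mul_le_iff₀ (by positivity)]; linarith
      set p := (jap x ^ (-(3 : ℝ) / 2)) ^ 2 with hp
      have hqp : q ^ 2 ≤ p := by
        have e : q ^ 2 = jap x ^ (-4 : ℝ) := by
          rw [hq, ← jap_sq, Real.rpow_neg (by have := jap_ge x; linarith)]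
          norm_cast
          rw [inv_pow, ← pow_mul]
        rw [e, hp, japw]
        exact Real.rpow_le_rpow_of_exponent_le (jap_ge x) (by norm_num)
      have hxm : ∀ m, (2 * x m * q ^ 2) ^ 2 ≤ 4 * p := by
        intro m
        have h1 : (2 * x m * q ^ 2) ^ 2 = 4 * (q * (x m) ^ 2) * (q * q ^ 2) := by ring
        have h2 : q * (x m) ^ 2 ≤ 1 := (mul_le_mul_of_nonneg_left (coord_sq_le x m) hq0.le).trans hqx
        have h3 : q * q ^ 2 ≤ p := by
          calc q * q ^ 2 ≤ 1 * q ^ 2 := by gcongr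
            _ ≤ p := by linarith
        rw [h1]
        calc 4 * (q * (x m) ^ 2) * (q * q ^ 2) ≤ 4 * 1 * p := by gcongr
          _ = 4 * p := by ring
      have t0 : q * f x * F x ≤ f x ^ 2 / 8 + 2 * F x ^ 2 := by
        have a1 : (q * F x) ^ 2 ≤ F x ^ 2 := by
          rw [mul_pow]
          have : q ^ 2 ≤ 1 := pow_le_one₀ hq0.le hq1
          nlinarith [sq_nonneg (F x)]
        nlinarith [sq_nonneg (f x / 2 - 2 * (q * F x)), sq_nonneg (f x - 4 * (q * F x))]
      have tm : ∀ m, (q * Ds m f x - 2 * x m * q ^ 2 * f x) * Ds m F x ≤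
          (1/2) * Ds m f x ^ 2 + f x ^ 2 / 8 + 9 * (p * Ds m F x ^ 2) := by
        intro m
        have a1 : (q * Ds m F x) ^ 2 ≤ p * Ds m F x ^ 2 := by
          rw [mul_pow]; gcongr
        have a2 : (2 * x m * q ^ 2 * Ds m F x) ^ 2 ≤ 4 * p * Ds m F x ^ 2 := by
          rw [mul_pow]; exact mul_le_mul_of_nonneg_right (hxm m) (sq_nonneg _)
        nlinarith [sq_nonneg (Ds m f x - q * Ds m F x), sq_nonneg (f x + 4 * (2 * x m * q ^ 2 * Ds m F x))]
      have ts := Finset.sum_le_sum (fun m (_ : m ∈ Finset.univ) => tm m)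
      simp only [Finset.sum_add_distrib, ← Finset.mul_sum] at ts
      simp at ts
      have : 0 ≤ F x ^ 2 := sq_nonneg _
      have : 0 ≤ f x ^ 2 := sq_nonneg _
      simp only at *
      linarith
  rw [← k2, ← k3, k1] at k4
  have i1 : Integrable fun x => (1/2:ℝ) * (f x ^ 2 + ∑ m, Ds m f x ^ 2) := ((int_sq f).add (hDsum f)).const_mul _
  have i2 : Integrable fun x => (9:ℝ) * (F x ^ 2 + (jap x ^ (-(3 : ℝ) / 2)) ^ 2 * ∑ m, (Ds m F x) ^ 2) :=
    ((int_sq F).add hI).const_mul _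
  rw [integral_add i1 i2,
    integral_const_mul, integral_const_mul] at k4
  have e5 : ∫ x, (f x * f x + ∑ m, Ds m f x * Ds m f x) = (∫ x, f x ^ 2) + ∫ x, ∑ m, Ds m f x ^ 2 := by
    rw [← integral_add (int_sq f) (hDsum f)]; simp only [sq]
  rw [e5, integral_add (int_sq f) (hDsum f), integral_add (int_sq F) hI] at k4
  have : 0 ≤ ∫ x, f x ^ 2 := integral_nonneg fun x => sq_nonneg _
  linarith

lemma sch_bdd (φ : SchwartzMap E3 ℝ) : ∃ M, 0 ≤ M ∧ ∀ x, |φ x| ≤ M := by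
  refine ⟨SchwartzMap.seminorm ℝ 0 0 φ, apply_nonneg _ _, fun x => ?_⟩
  have := SchwartzMap.norm_le_seminorm ℝ φ x
  simpa using this

lemma int_sing (φ : SchwartzMap E3 ℝ) (v : E3) : Integrable fun z => 1 / ‖v - z‖ * |φ z| := by
  obtain ⟨M, hM0, hM⟩ := sch_bdd φ
  have h1 : Integrable ((Metric.ball (0:E3) 1).indicator (fun z => 1 / ‖z‖ ^ 2)) := by
    refine ⟨?_, ?_⟩
    · apply Measurable.aestronglyMeasurable
      apply Measurable.indicator (by fun_prop) measurableSet_ball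
    · have := near_lint 1 one_pos
      rw [HasFiniteIntegral]
      have e : ∀ z : E3, ‖(Metric.ball (0:E3) 1).indicator (fun z => 1 / ‖z‖ ^ 2) z‖ₑ =
          (Metric.ball (0:E3) 1).indicator (fun z => ENNReal.ofReal (1 / ‖z‖ ^ 2)) z := by
        intro z
        rw [Real.enorm_of_nonneg (indicator_nonneg (fun _ _ => by positivity) _)]
        by_cases h : z ∈ Metric.ball (0:E3) 1
        · rw [indicator_of_mem h, indicator_of_mem h]
        · rw [indicator_of_notMem h, indicator_of_notMem h]; simp
      simp_rw [e]
      rw [this]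
      exact ENNReal.ofReal_lt_top
  have h2 : Integrable fun z => (Metric.ball (0:E3) 1).indicator (fun z => 1 / ‖z‖ ^ 2) (v - z) :=
    h1.comp_sub_left v
  have h3 : Integrable fun z => M * (Metric.ball (0:E3) 1).indicator (fun z => 1 / ‖z‖ ^ 2) (v - z) + |φ z| :=
    (h2.const_mul M).add φ.integrable.abs
  refine h3.mono' ?_ (Filter.Eventually.of_forall fun z => ?_)
  · apply Measurable.aestronglyMeasurable
    have := φ.continuous.measurable
    fun_prop
  · rw [Real.norm_eq_abs, abs_of_nonneg (by positivity)]
    set r := ‖v - z‖ with hr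
    have hr0 : 0 ≤ r := norm_nonneg _
    by_cases h : (v - z) ∈ Metric.ball (0:E3) 1
    · rw [indicator_of_mem h, ← hr]
      have hr1 : r < 1 := by simpa [hr] using h
      have : 1 / r ≤ 1 / r ^ 2 := by
        rcases hr0.eq_or_lt with h0 | h0
        · rw [← h0]; simp
        · apply one_div_le_one_div_of_le (by positivity); nlinarith
      have h4 : 1 / r * |φ z| ≤ 1 / r ^ 2 * M := mul_le_mul this (hM z) (abs_nonneg _) (by positivity)
      have := abs_nonneg (φ z)
      linarith
    · rw [indicator_of_notMem h]
      have hr1 : 1 ≤ r := by simpa [hr] using h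
      have : 1 / r ≤ 1 := by rw [div_le_one (by linarith)]; exact hr1
      have := mul_le_mul_of_nonneg_right this (abs_nonneg (φ z))
      linarith

open Filter Topology in
/-- Convergence of regularised singular convolutions. -/
lemma ker_conv (κ : ℕ → E3 → ℝ) (κ₀ : E3 → ℝ) (c : ℝ) (hm : ∀ n, Measurable (κ n))
    (hb : ∀ n z, z ≠ 0 → |κ n z| ≤ c * (1 / ‖z‖)) (hl : ∀ z, z ≠ 0 → Tendsto (fun n => κ n z) atTop (𝓝 (κ₀ z)))
    (φ : SchwartzMap E3 ℝ) (v : E3) :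
    Tendsto (fun n => ∫ z, κ n (v - z) * φ z) atTop (𝓝 (∫ z, κ₀ (v - z) * φ z)) := by
  have hφ := φ.continuous.measurable
  have hae : ∀ᵐ z : E3, z ≠ v := by
    rw [ae_iff]; simp
  refine tendsto_integral_of_dominated_convergence (fun z => c * (1 / ‖v - z‖ * |φ z|)) ?_ ((int_sing φ v).const_mul c) ?_ ?_
  · intro n
    apply Measurable.aestronglyMeasurable
    have := hm n
    fun_prop
  · intro n
    filter_upwards [hae] with z hz
    rw [Real.norm_eq_abs, abs_mul, ← mul_assoc]
    gcongr
    exact hb n _ (sub_ne_zero.2 hz.symm)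
  · filter_upwards [hae] with z hz
    exact (hl _ (sub_ne_zero.2 hz.symm)).mul_const _

lemma ker_ibp (κ κd : E3 → ℝ) (c : ℝ) (m : Fin 3) (hm : Continuous κ) (hmd : Continuous κd)
    (hb : ∀ z, |κ z| ≤ c) (hbd : ∀ z, |κd z| ≤ c)
    (hd : ∀ z, HasDerivAt (fun t : ℝ => κ (z + t • (EuclideanSpace.single m (1:ℝ) : E3))) (κd z) 0)
    (φ : SchwartzMap E3 ℝ) (v : E3) :
    ∫ z, κ (v - z) * Ds m φ z = ∫ z, κd (v - z) * φ z := by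
  have hInt : ∀ (κ : E3 → ℝ), Continuous κ → (∀ z, |κ z| ≤ c) → ∀ φ : SchwartzMap E3 ℝ, Integrable fun z => κ (v - z) * φ z := by
    intro κ hk hb φ
    refine φ.integrable.bdd_mul (c := c) ?_ (Filter.Eventually.of_forall fun z => ?_)
    · apply Continuous.aestronglyMeasurable; fun_prop
    · exact hb _
  have h := integral_bilinear_hasLineDerivAt_right_eq_neg_left_of_integrable (μ := volume)
    (f := fun z => κ (v - z)) (f' := fun z => - κd (v - z)) (g := φ) (g' := Ds m φ)
    (v := EuclideanSpace.single m (1:ℝ)) (B := ContinuousLinearMap.mul ℝ ℝ)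
    (by simpa using (hInt κd hmd hbd φ).neg) (by simpa using hInt κ hm hb (Ds m φ)) (by simpa using hInt κ hm hb φ)
    (fun x _ => by
      have h1 := hd (v - x)
      have h2 : HasDerivAt (fun t : ℝ => -t) (-1) 0 := hasDerivAt_neg 0
      have h1' : HasDerivAt (fun t : ℝ => κ ((v - x) + t • (EuclideanSpace.single m (1:ℝ) : E3))) (κd (v - x)) (-0) := by
        simpa using h1
      have h3 := HasDerivAt.comp (0:ℝ) h1' h2
      unfold HasLineDerivAt
      convert! h3 using 1
      · funext t
        simp only [Function.comp]
        congr 1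
        rw [neg_smul]; abel
      · ring)
    (fun x _ => Ds_line m φ x)
  simp only [ContinuousLinearMap.mul_apply', neg_mul, integral_neg, neg_neg] at h
  exact h

def rho (ε : ℝ) (z : E3) : ℝ := Real.sqrt (‖z‖ ^ 2 + ε ^ 2)

lemma rho_pos {ε : ℝ} (hε : 0 < ε) (z : E3) : 0 < rho ε z := Real.sqrt_pos.2 (by positivity)

lemma rho_sq (ε : ℝ) (z : E3) : rho ε z ^ 2 = ‖z‖ ^ 2 + ε ^ 2 := Real.sq_sqrt (by positivity)

lemma rho_cont (ε : ℝ) : Continuous (rho ε) := by unfold rho; fun_prop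

lemma norm_le_rho (ε : ℝ) (z : E3) : ‖z‖ ≤ rho ε z := by
  apply Real.le_sqrt_of_sq_le; nlinarith [sq_nonneg ε]

lemma eps_le_rho (ε : ℝ) (z : E3) : ε ≤ rho ε z := by
  apply Real.le_sqrt_of_sq_le; nlinarith [sq_nonneg ‖z‖]

lemma coord_le_rho (ε : ℝ) (z : E3) (m : Fin 3) : |z m| ≤ rho ε z := by
  refine le_trans ?_ (norm_le_rho ε z)
  have := PiLp.norm_apply_le z m
  simpa using this

lemma rho_line {ε : ℝ} (hε : 0 < ε) (z : E3) (m : Fin 3) :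
    HasDerivAt (fun t : ℝ => rho ε (z + t • (EuclideanSpace.single m (1:ℝ) : E3))) (z m / rho ε z) 0 := by
  have h := ((hasLine_nsq z m).add_const (ε ^ 2)).sqrt (by positivity)
  convert! h using 1
  simp only [zero_smul, add_zero, rho]
  rw [mul_div_mul_left _ _ two_ne_zero]

lemma coord_line (z : E3) (i m : Fin 3) :
    HasDerivAt (fun t : ℝ => (z + t • (EuclideanSpace.single m (1:ℝ) : E3)) i) (if i = m then 1 else 0) 0 := by
  have h := ((hasDerivAt_id (0:ℝ)).mul_const (if i = m then (1:ℝ) else 0)).const_add (z i)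
  convert! h using 1
  · funext t
    simp
  · simp

lemma coord_cont (i : Fin 3) : Continuous fun z : E3 => z i := by fun_prop

def bk0 (ε : ℝ) (z : E3) : ℝ := Real.exp (-rho ε z) * (rho ε z)⁻¹
def bk1 (ε : ℝ) (m : Fin 3) (z : E3) : ℝ :=
  -(Real.exp (-rho ε z) * ((rho ε z)⁻¹ ^ 2 + (rho ε z)⁻¹ ^ 3) * z m)
def bk2 (ε : ℝ) (m : Fin 3) (z : E3) : ℝ :=
  Real.exp (-rho ε z) * (((rho ε z)⁻¹ ^ 3 + 3 * (rho ε z)⁻¹ ^ 4 + 3 * (rho ε z)⁻¹ ^ 5) * z m ^ 2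
    - ((rho ε z)⁻¹ ^ 2 + (rho ε z)⁻¹ ^ 3))
def bq (ε : ℝ) (z : E3) : ℝ :=
  ε ^ 2 * Real.exp (-rho ε z) * ((rho ε z)⁻¹ ^ 3 + 3 * (rho ε z)⁻¹ ^ 4 + 3 * (rho ε z)⁻¹ ^ 5)

lemma sum_coord_sq (z : E3) : ∑ m, z m ^ 2 = ‖z‖ ^ 2 := by
  rw [EuclideanSpace.norm_sq_eq]; simp

lemma bq_eq {ε : ℝ} (hε : 0 < ε) (z : E3) : bk0 ε z - ∑ m, bk2 ε m z = bq ε z := by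
  have h := rho_pos hε z
  have h2 := rho_sq ε z
  have h3 : ∑ m, bk2 ε m z = Real.exp (-rho ε z) * (((rho ε z)⁻¹ ^ 3 + 3 * (rho ε z)⁻¹ ^ 4 + 3 * (rho ε z)⁻¹ ^ 5) * (rho ε z ^ 2 - ε ^ 2)
    - 3 * ((rho ε z)⁻¹ ^ 2 + (rho ε z)⁻¹ ^ 3)) := by
    rw [h2, add_sub_cancel_right, ← sum_coord_sq]
    simp only [bk2, Fin.sum_univ_three]
    ring
  rw [h3, bk0, bq]
  field_simp
  ring

lemma exp_rho_le {ε : ℝ} (hε : 0 < ε) (z : E3) : Real.exp (-rho ε z) ≤ 1 := by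
  rw [Real.exp_le_one_iff]; have := rho_pos hε z; linarith

lemma inv_line {ε : ℝ} (hε : 0 < ε) (z : E3) (m : Fin 3) :
    HasDerivAt (fun t : ℝ => (rho ε (z + t • (EuclideanSpace.single m (1:ℝ) : E3)))⁻¹) (-(z m * (rho ε z)⁻¹ ^ 3)) 0 := by
  have hp := rho_pos hε z
  have h := (rho_line hε z m).fun_inv (by simpa using hp.ne')
  convert! h using 1
  simp only [zero_smul, add_zero]
  field_simp

lemma exp_line {ε : ℝ} (hε : 0 < ε) (z : E3) (m : Fin 3) :
    HasDerivAt (fun t : ℝ => Real.exp (-rho ε (z + t • (EuclideanSpace.single m (1:ℝ) : E3))))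
      (-(Real.exp (-rho ε z) * z m * (rho ε z)⁻¹)) 0 := by
  have h := (rho_line hε z m).fun_neg.exp
  convert! h using 1
  simp only [zero_smul, add_zero]
  ring

lemma bk0_line {ε : ℝ} (hε : 0 < ε) (z : E3) (m : Fin 3) :
    HasDerivAt (fun t : ℝ => bk0 ε (z + t • (EuclideanSpace.single m (1:ℝ) : E3))) (bk1 ε m z) 0 := by
  have hp := rho_pos hε z
  have h := (exp_line hε z m).fun_mul (inv_line hε z m)
  convert! h using 1
  simp only [zero_smul, add_zero, bk1]
  ring

lemma bk1_line {ε : ℝ} (hε : 0 < ε) (z : E3) (m : Fin 3) :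
    HasDerivAt (fun t : ℝ => bk1 ε m (z + t • (EuclideanSpace.single m (1:ℝ) : E3))) (bk2 ε m z) 0 := by
  have hp := rho_pos hε z
  have hi := inv_line hε z m
  have h := (((exp_line hε z m).fun_mul ((hi.fun_pow 2).fun_add (hi.fun_pow 3))).fun_mul (coord_line z m m)).fun_neg
  convert! h using 1
  simp only [zero_smul, add_zero, bk2, if_true]
  push_cast
  ring

lemma bk_bounds {ε : ℝ} (hε : 0 < ε) (z : E3) (m : Fin 3) :
    |bk0 ε z| ≤ ε⁻¹ + 4 * ε⁻¹ ^ 2 + 4 * ε⁻¹ ^ 3 ∧ |bk1 ε m z| ≤ ε⁻¹ + 4 * ε⁻¹ ^ 2 + 4 * ε⁻¹ ^ 3 ∧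
    |bk2 ε m z| ≤ ε⁻¹ + 4 * ε⁻¹ ^ 2 + 4 * ε⁻¹ ^ 3 := by
  have hp := rho_pos hε z
  have he := exp_rho_le hε z
  have he0 := Real.exp_pos (-rho ε z)
  have hc := coord_le_rho ε z m
  have hs : (rho ε z)⁻¹ ≤ ε⁻¹ := inv_anti₀ hε (eps_le_rho ε z)
  unfold bk0 bk1 bk2
  set E := Real.exp (-rho ε z)
  set r := rho ε z
  have hz : |z m| * r⁻¹ ≤ 1 := by rw [← div_eq_mul_inv, div_le_one hp]; exact hc
  set s := r⁻¹
  have hs0 : 0 < s := inv_pos.2 hp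
  set S := ε⁻¹
  have hS : 0 < S := inv_pos.2 hε
  have p2 : s ^ 2 ≤ S ^ 2 := by gcongr
  have p3 : s ^ 3 ≤ S ^ 3 := by gcongr
  have q2 : 0 < S ^ 2 := by positivity
  have q3 : 0 < S ^ 3 := by positivity
  have hz0 : 0 ≤ |z m| * s := by positivity
  refine ⟨?_, ?_, ?_⟩
  · rw [abs_of_pos (by positivity)]
    have : E * s ≤ 1 * s := by gcongr
    linarith
  · rw [abs_neg, abs_mul, abs_of_pos (by positivity)]
    have e : E * (s ^ 2 + s ^ 3) * |z m| = E * ((s + s ^ 2) * (|z m| * s)) := by ring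
    rw [e]
    have : E * ((s + s ^ 2) * (|z m| * s)) ≤ 1 * ((s + s ^ 2) * 1) := by gcongr
    linarith
  · rw [abs_mul, abs_of_pos he0]
    have e : (s ^ 3 + 3 * s ^ 4 + 3 * s ^ 5) * z m ^ 2 = (s + 3 * s ^ 2 + 3 * s ^ 3) * (|z m| * s) ^ 2 := by
      rw [mul_pow, sq_abs]; ring
    have e1 : (|z m| * s) ^ 2 ≤ 1 := pow_le_one₀ hz0 hz
    have e2 : (s + 3 * s ^ 2 + 3 * s ^ 3) * (|z m| * s) ^ 2 ≤ (s + 3 * s ^ 2 + 3 * s ^ 3) * 1 := by gcongr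
    have e3 : 0 ≤ (s + 3 * s ^ 2 + 3 * s ^ 3) * (|z m| * s) ^ 2 := by positivity
    have e4 : 0 ≤ s ^ 2 + s ^ 3 := by positivity
    have e5 : |(s ^ 3 + 3 * s ^ 4 + 3 * s ^ 5) * z m ^ 2 - (s ^ 2 + s ^ 3)| ≤ s + 4 * s ^ 2 + 4 * s ^ 3 := by
      rw [e, abs_le]; constructor <;> nlinarith
    calc E * |(s ^ 3 + 3 * s ^ 4 + 3 * s ^ 5) * z m ^ 2 - (s ^ 2 + s ^ 3)| ≤ 1 * (s + 4 * s ^ 2 + 4 * s ^ 3) := by gcongr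
      _ ≤ _ := by linarith

lemma bk_cont {ε : ℝ} (hε : 0 < ε) (m : Fin 3) : Continuous (bk0 ε) ∧ Continuous (bk1 ε m) ∧ Continuous (bk2 ε m) := by
  have h1 := rho_cont ε
  have h2 : Continuous fun z => (rho ε z)⁻¹ := h1.inv₀ (fun z => (rho_pos hε z).ne')
  have h3 : Continuous fun z : E3 => z m := coord_cont m
  unfold bk0 bk1 bk2
  refine ⟨by fun_prop, by fun_prop, by fun_prop⟩

/-- `f - Δ f` as a Schwartz function. -/
def helm (f : SchwartzMap E3 ℝ) : SchwartzMap E3 ℝ := f - ∑ m, Ds m (Ds m f)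

lemma helm_apply (f : SchwartzMap E3 ℝ) (x : E3) : helm f x = f x - ∑ m, Ds m (Ds m f) x := by
  simp [helm]

lemma bk_helm {ε : ℝ} (hε : 0 < ε) (f : SchwartzMap E3 ℝ) (v : E3) :
    ∫ z, bk0 ε (v - z) * helm f z = ∫ z, bq ε (v - z) * f z := by
  set c := ε⁻¹ + 4 * ε⁻¹ ^ 2 + 4 * ε⁻¹ ^ 3
  have hInt : ∀ (κ : E3 → ℝ), Continuous κ → (∀ z, |κ z| ≤ c) → ∀ φ : SchwartzMap E3 ℝ, Integrable fun z => κ (v - z) * φ z := by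
    intro κ hk hb φ
    refine φ.integrable.bdd_mul (c := c) ?_ (Filter.Eventually.of_forall fun z => ?_)
    · apply Continuous.aestronglyMeasurable; fun_prop
    · exact hb _
  have i0 : ∀ φ : SchwartzMap E3 ℝ, Integrable fun z => bk0 ε (v - z) * φ z :=
    hInt _ (bk_cont hε 0).1 fun z => (bk_bounds hε z 0).1
  have i2 : ∀ m, ∀ φ : SchwartzMap E3 ℝ, Integrable fun z => bk2 ε m (v - z) * φ z := fun m =>
    hInt _ (bk_cont hε m).2.2 fun z => (bk_bounds hε z m).2.2
  have ib : ∀ m, ∫ z, bk0 ε (v - z) * Ds m (Ds m f) z = ∫ z, bk2 ε m (v - z) * f z := by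
    intro m
    rw [ker_ibp (bk0 ε) (bk1 ε m) c m (bk_cont hε m).1 (bk_cont hε m).2.1 (fun z => (bk_bounds hε z m).1)
      (fun z => (bk_bounds hε z m).2.1) (fun z => bk0_line hε z m),
      ker_ibp (bk1 ε m) (bk2 ε m) c m (bk_cont hε m).2.1 (bk_cont hε m).2.2 (fun z => (bk_bounds hε z m).2.1)
      (fun z => (bk_bounds hε z m).2.2) (fun z => bk1_line hε z m)]
  simp_rw [← bq_eq hε, helm_apply, mul_sub, sub_mul, Finset.mul_sum, Finset.sum_mul]
  rw [integral_sub (i0 f) (integrable_finsetSum _ fun m _ => i0 _),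
    integral_sub (i0 f) (integrable_finsetSum _ fun m _ => i2 m _),
    integral_finsetSum _ (fun m _ => i0 _), integral_finsetSum _ (fun m _ => i2 m _)]
  simp_rw [ib]

lemma rho_scale {ε : ℝ} (hε : 0 < ε) (y : E3) : rho ε (ε • y) = ε * rho 1 y := by
  unfold rho
  rw [norm_smul, Real.norm_of_nonneg hε.le, mul_pow, one_pow, show ε ^ 2 * ‖y‖ ^ 2 + ε ^ 2 = ε ^ 2 * (‖y‖ ^ 2 + 1) by ring,
    Real.sqrt_mul (by positivity), Real.sqrt_sq hε.le]

lemma bq_scale {ε : ℝ} (hε : 0 < ε) (y : E3) : ε ^ 3 * bq ε (ε • y) =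
    Real.exp (-(ε * rho 1 y)) * (ε ^ 2 * (rho 1 y)⁻¹ ^ 3 + 3 * ε * (rho 1 y)⁻¹ ^ 4 + 3 * (rho 1 y)⁻¹ ^ 5) := by
  have := rho_pos one_pos y
  unfold bq
  rw [rho_scale hε]
  field_simp

lemma bq_scale_le {ε : ℝ} (hε : 0 < ε) (h1 : ε ≤ 1) (y : E3) : |ε ^ 3 * bq ε (ε • y)| ≤ 7 * (rho 1 y)⁻¹ ^ 4 := by
  rw [bq_scale hε]
  have hp := rho_pos one_pos y
  have h1r := eps_le_rho 1 y
  set r := rho 1 y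
  have hx : Real.exp (-(ε * r)) * (ε * r) ≤ 1 := by
    rw [Real.exp_neg, inv_mul_le_iff₀ (Real.exp_pos _), mul_one]
    have := Real.add_one_le_exp (ε * r); linarith
  have he : Real.exp (-(ε * r)) ≤ 1 := by
    rw [Real.exp_le_one_iff]; have : 0 < ε * r := by positivity
    linarith
  have he0 := Real.exp_pos (-(ε * r))
  set E := Real.exp (-(ε * r))
  rw [abs_of_pos (by positivity)]
  have hs1 : r⁻¹ ≤ 1 := inv_le_one_of_one_le₀ h1r
  have e : E * (ε ^ 2 * r⁻¹ ^ 3 + 3 * ε * r⁻¹ ^ 4 + 3 * r⁻¹ ^ 5) =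
      (ε * (E * (ε * r)) + 3 * (ε * E) + 3 * (E * r⁻¹)) * r⁻¹ ^ 4 := by
    field_simp
  rw [e]
  have hs0 : 0 < r⁻¹ := by positivity
  have a1 : ε * (E * (ε * r)) ≤ 1 * 1 := by gcongr
  have a2 : ε * E ≤ 1 * 1 := by gcongr
  have a3 : E * r⁻¹ ≤ 1 * 1 := by gcongr
  gcongr
  linarith

/-- The value of the total mass of the regularised delta. -/
def cB : ℝ := ∫ y : E3, 3 * (rho 1 y)⁻¹ ^ 5

def eps (n : ℕ) : ℝ := 1 / ((n:ℝ) + 1)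
lemma eps_pos (n : ℕ) : 0 < eps n := by unfold eps; positivity
lemma eps_le (n : ℕ) : eps n ≤ 1 := by
  unfold eps; rw [div_le_one (by positivity)]; linarith [(Nat.cast_nonneg n : (0:ℝ) ≤ n)]

open Filter Topology

lemma eps_tendsto : Tendsto eps atTop (𝓝 0) := tendsto_one_div_add_atTop_nhds_zero_nat

lemma rho_tendsto (z : E3) : Tendsto (fun n => rho (eps n) z) atTop (𝓝 ‖z‖) := by
  have h : Tendsto (fun n => Real.sqrt (‖z‖ ^ 2 + eps n ^ 2)) atTop (𝓝 (Real.sqrt (‖z‖ ^ 2 + 0 ^ 2))) :=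
    ((eps_tendsto.pow 2).const_add _).sqrt
  simpa [rho] using h

lemma bq_lim (f : SchwartzMap E3 ℝ) (v : E3) :
    Tendsto (fun n => ∫ z, bq (eps n) (v - z) * f z) atTop (𝓝 (cB * f v)) := by
  obtain ⟨M, hM0, hM⟩ := sch_bdd f
  have e : ∀ n, ∫ z, bq (eps n) (v - z) * f z = ∫ y, (eps n ^ 3 * bq (eps n) (eps n • y)) * f (v - eps n • y) := by
    intro n
    have h1 := integral_sub_left_eq_self (fun z => bq (eps n) z * f (v - z)) volume v
    have h2 := Measure.integral_comp_smul (volume : Measure E3) (fun z => bq (eps n) z * f (v - z)) (eps n)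
    simp only [sub_sub_cancel] at h1
    rw [h1]
    simp_rw [mul_assoc]
    rw [integral_const_mul, h2]
    have := eps_pos n
    simp only [finrank_euclideanSpace, Fintype.card_fin, smul_eq_mul]
    rw [abs_of_pos (by positivity), mul_inv_cancel_left₀ (by positivity)]
  simp_rw [e]
  have hInt : Integrable fun y : E3 => 7 * (rho 1 y)⁻¹ ^ 4 * M := by
    have h := (integrable_rpow_neg_one_add_norm_sq (E := E3) (μ := volume) (r := 4) (by simp; norm_num))
    have h2 : (fun x : E3 => ((1 : ℝ) + ‖x‖ ^ 2) ^ (-4 / 2 : ℝ)) = fun y => (rho 1 y)⁻¹ ^ 4 := by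
      funext y
      have e1 : (rho 1 y)⁻¹ ^ 4 = ((rho 1 y ^ 2) ^ 2)⁻¹ := by rw [inv_pow]; ring_nf
      rw [e1, rho_sq, show (-4 / 2 : ℝ) = -(2:ℝ) by norm_num, Real.rpow_neg (by positivity)]
      norm_num
      ring
    rw [h2] at h
    exact (h.const_mul 7).mul_const M
  have hc : cB * f v = ∫ y, 3 * (rho 1 y)⁻¹ ^ 5 * f v := by rw [integral_mul_const, cB]
  rw [hc]
  have hfm := f.continuous.measurable
  have hrm : ∀ ε, Measurable (rho ε) := fun ε => (rho_cont ε).measurable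
  refine tendsto_integral_of_dominated_convergence _ ?_ hInt ?_ ?_
  · intro n
    apply Measurable.aestronglyMeasurable
    have := hrm (eps n)
    unfold bq
    fun_prop
  · intro n
    refine Eventually.of_forall fun y => ?_
    rw [norm_mul]
    exact mul_le_mul (bq_scale_le (eps_pos n) (eps_le n) y) (hM _) (norm_nonneg _) (by positivity [rho_pos one_pos y])
  · refine Eventually.of_forall fun y => ?_
    simp_rw [bq_scale (eps_pos _)]
    have h1 : Continuous fun ε : ℝ => Real.exp (-(ε * rho 1 y)) * (ε ^ 2 * (rho 1 y)⁻¹ ^ 3 + 3 * ε * (rho 1 y)⁻¹ ^ 4 + 3 * (rho 1 y)⁻¹ ^ 5) * f (v - ε • y) := by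
      have := f.continuous
      fun_prop
    have h2 := (h1.tendsto 0).comp eps_tendsto
    simpa [Function.comp_def] using h2

lemma bessel_helm (f : SchwartzMap E3 ℝ) (v : E3) :
    besselM (helm f) v = (1 / (4 * Real.pi)) * cB * f v := by
  have h1 : Tendsto (fun n => ∫ z, bk0 (eps n) (v - z) * helm f z) atTop
      (𝓝 (∫ z, Real.exp (-‖v - z‖) / ‖v - z‖ * helm f z)) := by
    refine ker_conv (fun n => bk0 (eps n)) (fun z => Real.exp (-‖z‖) / ‖z‖) 1 ?_ ?_ ?_ (helm f) v
    · exact fun n => (bk_cont (eps_pos n) 0).1.measurable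
    · intro n z hz
      have hp := rho_pos (eps_pos n) z
      have he := exp_rho_le (eps_pos n) z
      rw [bk0, abs_of_pos (by positivity)]
      have : (rho (eps n) z)⁻¹ ≤ ‖z‖⁻¹ := inv_anti₀ (norm_pos_iff.2 hz) (norm_le_rho _ _)
      rw [one_div]
      gcongr
    · intro z hz
      have h := rho_tendsto z
      have := ((Real.continuous_exp.tendsto _).comp h.neg).mul (h.inv₀ (norm_ne_zero_iff.2 hz))
      simpa [bk0, div_eq_mul_inv] using this
  have h2 := bq_lim f v
  simp_rw [← bk_helm (eps_pos _)] at h2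
  have h3 := tendsto_nhds_unique h1 h2
  rw [besselM, h3, mul_assoc]

def kd (i j : Fin 3) : ℝ := if i = j then 1 else 0

lemma kd_abs (i j : Fin 3) : |kd i j| ≤ 1 := by unfold kd; split_ifs <;> simp

def lk0 (ε : ℝ) (i j : Fin 3) (z : E3) : ℝ := kd i j * (rho ε z)⁻¹ - z i * z j * (rho ε z)⁻¹ ^ 3
def lk1 (ε : ℝ) (i j m : Fin 3) (z : E3) : ℝ :=
  -(kd i j * (z m * (rho ε z)⁻¹ ^ 3)) - (kd i m * z j + z i * kd j m) * (rho ε z)⁻¹ ^ 3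
    + 3 * (z i * z j * z m) * (rho ε z)⁻¹ ^ 5

lemma lk_line {ε : ℝ} (hε : 0 < ε) (z : E3) (i j m : Fin 3) :
    HasDerivAt (fun t : ℝ => lk0 ε i j (z + t • (EuclideanSpace.single m (1:ℝ) : E3))) (lk1 ε i j m z) 0 := by
  have hi := inv_line hε z m
  have h := (hi.const_mul (kd i j)).fun_sub (((coord_line z i m).fun_mul (coord_line z j m)).fun_mul (hi.fun_pow 3))
  convert! h using 1
  simp only [zero_smul, add_zero, lk1, kd]
  push_cast
  ring

lemma lk_bounds {ε : ℝ} (hε : 0 < ε) (z : E3) (i j m : Fin 3) :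
    |lk0 ε i j z| ≤ 2 * (rho ε z)⁻¹ ∧ |lk1 ε i j m z| ≤ 6 * (rho ε z)⁻¹ ^ 2 := by
  have hp := rho_pos hε z
  have hzz : ∀ k, |z k * (rho ε z)⁻¹| ≤ 1 := by
    intro k
    rw [abs_mul, abs_of_pos (inv_pos.2 hp), ← div_eq_mul_inv, div_le_one hp]; exact coord_le_rho ε z k
  unfold lk0 lk1
  set s := (rho ε z)⁻¹
  have hs0 : 0 < s := inv_pos.2 hp
  have e1 : kd i j * s - z i * z j * s ^ 3 = (kd i j - (z i * s) * (z j * s)) * s := by ring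
  have e2 : -(kd i j * (z m * s ^ 3)) - (kd i m * z j + z i * kd j m) * s ^ 3 + 3 * (z i * z j * z m) * s ^ 5 =
    (-(kd i j * (z m * s)) - kd i m * (z j * s) - kd j m * (z i * s) + 3 * ((z i * s) * (z j * s) * (z m * s))) * s ^ 2 := by ring
  rw [e1, e2, abs_mul, abs_mul, abs_of_pos hs0, abs_of_pos (pow_pos hs0 2)]
  have h2 : ∀ a b : ℝ, |a| ≤ 1 → |b| ≤ 1 → |a * b| ≤ 1 := fun a b ha hb => by
    rw [abs_mul]; exact mul_le_one₀ ha (abs_nonneg _) hb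
  have b1 := h2 _ _ (hzz i) (hzz j)
  have b2 := h2 _ _ b1 (hzz m)
  have b3 := h2 _ _ (kd_abs i j) (hzz m)
  have b4 := h2 _ _ (kd_abs i m) (hzz j)
  have b5 := h2 _ _ (kd_abs j m) (hzz i)
  have b6 := kd_abs i j
  rw [abs_le] at b1 b2 b3 b4 b5 b6
  constructor
  · gcongr
    rw [abs_le]; constructor <;> linarith
  · gcongr
    rw [abs_le]; constructor <;> linarith

lemma lk_cont {ε : ℝ} (hε : 0 < ε) (i j m : Fin 3) : Continuous (lk0 ε i j) ∧ Continuous (lk1 ε i j m) := by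
  have h1 := rho_cont ε
  have h2 : Continuous fun z => (rho ε z)⁻¹ := h1.inv₀ (fun z => (rho_pos hε z).ne')
  unfold lk0 lk1
  refine ⟨by fun_prop, by fun_prop⟩

lemma lk_eps {ε : ℝ} (hε : 0 < ε) (f : SchwartzMap E3 ℝ) (v : E3) (i j : Fin 3) :
    ‖∫ z, lk0 ε i j (v - z) * (∑ m, Ds m (Ds m f)) z‖ₑ ≤
      ∫⁻ z, ker2 (v - z) * ENNReal.ofReal (6 * ∑ m, |Ds m f z|) := by
  set c := 2 * ε⁻¹ + 6 * ε⁻¹ ^ 2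
  have hs : ∀ z, (rho ε z)⁻¹ ≤ ε⁻¹ := fun z => inv_anti₀ hε (eps_le_rho ε z)
  have hs0 : ∀ z, 0 < (rho ε z)⁻¹ := fun z => inv_pos.2 (rho_pos hε z)
  have hε' : 0 < ε⁻¹ := inv_pos.2 hε
  have hb0 : ∀ z, |lk0 ε i j z| ≤ c := fun z => by
    have h1 := (lk_bounds hε z i j 0).1
    have h2 := hs z
    have h3 : 0 < ε⁻¹ ^ 2 := by positivity
    linarith
  have hb1 : ∀ m z, |lk1 ε i j m z| ≤ c := fun m z => by
    have h1 := (lk_bounds hε z i j m).2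
    have h2 : (rho ε z)⁻¹ ^ 2 ≤ ε⁻¹ ^ 2 := pow_le_pow_left₀ (hs0 z).le (hs z) 2
    linarith
  have hInt : ∀ (κ : E3 → ℝ), Continuous κ → (∀ z, |κ z| ≤ c) → ∀ φ : SchwartzMap E3 ℝ, Integrable fun z => κ (v - z) * φ z := by
    intro κ hk hb φ
    refine φ.integrable.bdd_mul (c := c) ?_ (Filter.Eventually.of_forall fun z => ?_)
    · apply Continuous.aestronglyMeasurable; fun_prop
    · exact hb _
  have e : ∫ z, lk0 ε i j (v - z) * (∑ m, Ds m (Ds m f)) z = ∫ z, ∑ m, lk1 ε i j m (v - z) * Ds m f z := by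
    have e0 : ∀ z, lk0 ε i j (v - z) * (∑ m, Ds m (Ds m f)) z = ∑ m, lk0 ε i j (v - z) * Ds m (Ds m f) z := by
      intro z; rw [sum_apply, Finset.mul_sum]
    simp_rw [e0]
    rw [integral_finsetSum _ (fun m _ => hInt _ (lk_cont hε i j m).1 hb0 _),
      integral_finsetSum _ (fun m _ => hInt _ (lk_cont hε i j m).2 (hb1 m) _)]
    refine Finset.sum_congr rfl fun m _ => ?_
    exact ker_ibp _ _ c m (lk_cont hε i j m).1 (lk_cont hε i j m).2 hb0 (hb1 m) (fun z => lk_line hε z i j m) _ v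
  rw [e]
  refine (enorm_integral_le_lintegral_enorm _).trans ?_
  have hae : ∀ᵐ z : E3, z ≠ v := by
    rw [ae_iff]; simp
  apply lintegral_mono_ae
  filter_upwards [hae] with z hz
  have hn : 0 < ‖v - z‖ := norm_pos_iff.2 (sub_ne_zero.2 hz.symm)
  rw [ker2, ← ENNReal.ofReal_mul (by positivity), Real.enorm_eq_ofReal_abs]
  apply ENNReal.ofReal_le_ofReal
  refine (Finset.abs_sum_le_sum_abs _ _).trans ?_
  rw [← mul_assoc, Finset.mul_sum]
  refine Finset.sum_le_sum fun m _ => ?_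
  rw [abs_mul]
  gcongr
  refine (lk_bounds hε _ i j m).2.trans ?_
  have : (rho ε (v - z))⁻¹ ≤ ‖v - z‖⁻¹ := inv_anti₀ hn (norm_le_rho _ _)
  have h2 : (rho ε (v - z))⁻¹ ^ 2 ≤ ‖v - z‖⁻¹ ^ 2 := pow_le_pow_left₀ (hs0 _).le this 2
  rw [one_div, ← inv_pow]
  linarith

lemma landau_pt (f : SchwartzMap E3 ℝ) (v : E3) (i j : Fin 3) :
    ‖∫ z, Pker (v - z) i j / ‖v - z‖ * (∑ m, Ds m (Ds m f)) z‖ₑ ≤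
      ∫⁻ z, ker2 (v - z) * ENNReal.ofReal (6 * ∑ m, |Ds m f z|) := by
  have h1 : Tendsto (fun n => ∫ z, lk0 (eps n) i j (v - z) * (∑ m, Ds m (Ds m f)) z) atTop
      (𝓝 (∫ z, Pker (v - z) i j / ‖v - z‖ * (∑ m, Ds m (Ds m f)) z)) := by
    refine ker_conv (fun n => lk0 (eps n) i j) (fun z => Pker z i j / ‖z‖) 2 ?_ ?_ ?_ _ v
    · exact fun n => (lk_cont (eps_pos n) i j 0).1.measurable
    · intro n z hz
      refine (lk_bounds (eps_pos n) z i j 0).1.trans ?_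
      have : (rho (eps n) z)⁻¹ ≤ ‖z‖⁻¹ := inv_anti₀ (norm_pos_iff.2 hz) (norm_le_rho _ _)
      rw [one_div]
      gcongr
    · intro z hz
      have h := (rho_tendsto z).inv₀ (norm_ne_zero_iff.2 hz)
      have h2 := (h.const_mul (kd i j)).sub ((h.pow 3).const_mul (z i * z j))
      have e : Pker z i j / ‖z‖ = kd i j * ‖z‖⁻¹ - z i * z j * ‖z‖⁻¹ ^ 3 := by
        have := norm_ne_zero_iff.2 hz
        unfold Pker kd
        field_simp
      rw [e]
      exact h2
  have h2 := (continuous_enorm.tendsto _).comp h1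
  exact le_of_tendsto h2 (Eventually.of_forall fun n => lk_eps (eps_pos n) f v i j)

lemma Ds_smul (c : ℝ) (m : Fin 3) (f : SchwartzMap E3 ℝ) : Ds m (c • f) = c • Ds m f := by
  unfold Ds
  rw [LineDeriv.lineDerivOp_smul]

lemma helm_smul (c : ℝ) (f : SchwartzMap E3 ℝ) (x : E3) : helm (c • f) x = c * helm f x := by
  simp only [helm_apply, Ds_smul, smul_apply, smul_eq_mul, mul_sub, Finset.mul_sum]

lemma snorm6 (g : E3 → ℝ) : eLpNorm g 6 volume ^ 6 = ∫⁻ x, ‖g x‖ₑ ^ 6 := by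
  have h : eLpNorm g 6 volume ^ (6:ℝ) = ∫⁻ x, ‖g x‖ₑ ^ (6:ℝ) :=
    eLpNorm_nnreal_pow_eq_lintegral (μ := volume) (f := g) (p := 6) (by norm_num)
  have e : ∀ t : ℝ≥0∞, t ^ (6:ℝ) = t ^ 6 := fun t => by
    rw [← ENNReal.rpow_natCast]; norm_num
  simp_rw [e] at h
  exact h

lemma snorm2 (g : E3 → ℝ) : eLpNorm g 2 volume ^ 2 = ∫⁻ x, ‖g x‖ₑ ^ 2 := by
  have h : eLpNorm g 2 volume ^ (2:ℝ) = ∫⁻ x, ‖g x‖ₑ ^ (2:ℝ) :=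
    eLpNorm_nnreal_pow_eq_lintegral (μ := volume) (f := g) (p := 2) (by norm_num)
  have e : ∀ t : ℝ≥0∞, t ^ (2:ℝ) = t ^ 2 := fun t => by
    rw [← ENNReal.rpow_natCast]; norm_num
  simp_rw [e] at h
  exact h

lemma snorm2' (g : E3 → ℝ) (hg : Integrable fun x => g x ^ 2) :
    eLpNorm g 2 volume ^ 2 = ENNReal.ofReal (∫ x, g x ^ 2) := by
  rw [snorm2, ofReal_integral_eq_lintegral_ofReal hg (Eventually.of_forall fun x => sq_nonneg _)]
  congr 1
  funext x
  rw [Real.enorm_eq_ofReal_abs, ← ENNReal.ofReal_pow (abs_nonneg _), sq_abs]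

lemma bound_fF (f F : SchwartzMap E3 ℝ)
    (h : ∀ x, f x - ∑ m, pd m (pd m f) x = (jap x ^ 2)⁻¹ * (F x - ∑ m, pd m (pd m F) x)) :
    eLpNorm (fun v => ∑ i, ∑ j, |LandauA (fun u => ∑ m, pd m (pd m f) u) v i j|) 6 volume
      ≤ ENNReal.ofReal (45 * (1 + 6 * 256 * sphC ^ 4)) *
          (eLpNorm (fun v => jap v ^ (-(3 : ℝ) / 2) * gradNorm F v) 2 volume + eLpNorm F 2 volume) := by
  obtain ⟨hI, hE⟩ := energy f F h
  have hsp := sphC_pos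
  set D := 6 * 256 * sphC ^ 4 with hD
  have hD0 : 0 < D := by positivity
  set A := ∫ x, F x ^ 2 with hA
  set B := ∫ x, (jap x ^ (-(3 : ℝ) / 2)) ^ 2 * ∑ m, (Ds m F x) ^ 2 with hB
  have hA0 : 0 ≤ A := integral_nonneg fun x => sq_nonneg _
  have hB0 : 0 ≤ B := integral_nonneg fun x => by positivity
  have ha : eLpNorm F 2 volume ^ 2 = ENNReal.ofReal A := snorm2' F (int_sq F)
  have hg : ∀ x, (jap x ^ (-(3 : ℝ) / 2) * gradNorm F x) ^ 2 = (jap x ^ (-(3 : ℝ) / 2)) ^ 2 * ∑ m, (Ds m F x) ^ 2 := by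
    intro x
    rw [mul_pow, gradNorm, gradNormSq, Real.sq_sqrt (by positivity)]
    simp_rw [pd_eq]
  have hb : eLpNorm (fun v => jap v ^ (-(3 : ℝ) / 2) * gradNorm F v) 2 volume ^ 2 = ENNReal.ofReal B := by
    rw [snorm2']
    · simp_rw [hg]; rfl
    · simp_rw [hg]; exact hI
  set a := eLpNorm F 2 volume
  set b := eLpNorm (fun v => jap v ^ (-(3 : ℝ) / 2) * gradNorm F v) 2 volume
  set N := Real.sqrt (1944 * (A + B)) with hN
  have hN0 : 0 ≤ N := Real.sqrt_nonneg _
  have hN2 : N ^ 2 = 1944 * (A + B) := Real.sq_sqrt (by positivity)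
  have hNab : ENNReal.ofReal N ≤ 45 * (b + a) := by
    have : ENNReal.ofReal N ^ 2 ≤ (45 * (b + a)) ^ 2 := by
      rw [← ENNReal.ofReal_pow hN0, hN2, ENNReal.ofReal_mul (by norm_num), ENNReal.ofReal_add hA0 hB0, ← ha, ← hb, mul_pow]
      have h1 : a ^ 2 + b ^ 2 ≤ (b + a) ^ 2 := by
        have : (b + a) ^ 2 = a ^ 2 + b ^ 2 + 2 * a * b := by ring
        rw [this]; exact le_self_add
      have h2 : ENNReal.ofReal 1944 ≤ 45 ^ 2 := by
        rw [show (45:ℝ≥0∞) ^ 2 = ENNReal.ofReal (45 ^ 2) by rw [ENNReal.ofReal_pow (by norm_num)]; norm_num]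
        exact ENNReal.ofReal_le_ofReal (by norm_num)
      exact mul_le_mul' h2 h1
    exact (ENNReal.pow_le_pow_left_iff two_ne_zero).1 this
  -- the source
  set hh : E3 → ℝ := fun y => 6 * ∑ m, |Ds m f y| with hhd
  have hh0 : ∀ y, 0 ≤ hh y := fun y => by simp only [hhd]; positivity
  choose M hM0 hM using fun m => sch_bdd (Ds m f)
  have hhB : ∀ y, hh y ≤ 6 * ∑ m, M m := by
    intro y
    simp only [hhd]
    gcongr with m
    exact hM m y
  have hhm : Measurable hh := by
    have : ∀ m, Measurable (Ds m f) := fun m => (Ds m f).continuous.measurable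
    simp only [hhd]
    fun_prop
  have hDsum : Integrable fun x => ∑ m, (Ds m f x) ^ 2 :=
    integrable_finsetSum _ fun m _ => int_sq _
  have hhN : ∫⁻ y, ENNReal.ofReal (hh y) ^ 2 ≤ ENNReal.ofReal (N ^ 2) := by
    calc ∫⁻ y, ENNReal.ofReal (hh y) ^ 2 ≤ ∫⁻ y, ENNReal.ofReal (108 * ∑ m, (Ds m f y) ^ 2) := by
          apply lintegral_mono
          intro y
          dsimp only
          rw [← ENNReal.ofReal_pow (hh0 y)]
          apply ENNReal.ofReal_le_ofReal
          simp only [hhd, Fin.sum_univ_three, ← sq_abs (Ds _ f y)]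
          nlinarith [sq_nonneg (|Ds 0 f y| - |Ds 1 f y|), sq_nonneg (|Ds 0 f y| - |Ds 2 f y|), sq_nonneg (|Ds 1 f y| - |Ds 2 f y|)]
      _ = ENNReal.ofReal (∫ y, 108 * ∑ m, (Ds m f y) ^ 2) := by
          rw [ofReal_integral_eq_lintegral_ofReal (hDsum.const_mul _)]
          exact Eventually.of_forall fun x => by dsimp only; positivity
      _ ≤ _ := by
          rw [integral_const_mul, hN2]
          apply ENNReal.ofReal_le_ofReal
          linarith
  have H := hls _ hh hhm hh0 hhB N hN0 hhN
  have hpt : ∀ v, ‖∑ i, ∑ j, |LandauA (fun u => ∑ m, pd m (pd m f) u) v i j|‖ₑ ≤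
      ∫⁻ y, ker2 (v - y) * ENNReal.ofReal (hh y) := by
    intro v
    set T := ∫⁻ y, ker2 (v - y) * ENNReal.ofReal (hh y) with hT
    have h1 : ∀ i j, ‖|LandauA (fun u => ∑ m, pd m (pd m f) u) v i j|‖ₑ ≤ ENNReal.ofReal (1/9) * T := by
      intro i j
      have hl := landau_pt f v i j
      rw [Real.enorm_abs]
      unfold LandauA
      rw [enorm_mul]
      have e : (fun u => ∑ m, pd m (pd m f) u) = ⇑(∑ m, Ds m (Ds m f)) := by
        funext u
        simp only [pd_eq, sum_apply]
      rw [e]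
      refine mul_le_mul' ?_ hl
      rw [Real.enorm_of_nonneg (by positivity)]
      apply ENNReal.ofReal_le_ofReal
      apply one_div_le_one_div_of_le (by norm_num)
      linarith [Real.pi_gt_three]
    calc _ ≤ ∑ i : Fin 3, ∑ j : Fin 3, ENNReal.ofReal (1/9) * T := by
          refine (enorm_sum_le _ _).trans (Finset.sum_le_sum fun i _ => ?_)
          exact (enorm_sum_le _ _).trans (Finset.sum_le_sum fun j _ => h1 i j)
      _ = (9 * ENNReal.ofReal (1/9)) * T := by
          simp only [Fin.sum_univ_three]; ring
      _ = T := by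
          rw [show (9:ℝ≥0∞) = ENNReal.ofReal 9 by norm_num, ← ENNReal.ofReal_mul (by norm_num)]
          norm_num
  refine (ENNReal.pow_le_pow_left_iff (n := 6) (by norm_num)).1 ?_
  rw [snorm6]
  calc _ ≤ ∫⁻ v, (∫⁻ y, ker2 (v - y) * ENNReal.ofReal (hh y)) ^ 6 :=
        lintegral_mono fun v => pow_le_pow_left' (hpt v) 6
    _ ≤ ENNReal.ofReal (D * N ^ 6) := H
    _ = ENNReal.ofReal D * ENNReal.ofReal N ^ 6 := by
        rw [ENNReal.ofReal_mul hD0.le, ENNReal.ofReal_pow hN0]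
    _ ≤ ENNReal.ofReal ((1 + D) ^ 6) * (45 * (b + a)) ^ 6 := by
        refine mul_le_mul' (ENNReal.ofReal_le_ofReal ?_) (pow_le_pow_left' hNab 6)
        calc D ≤ (1 + D) ^ 1 := by linarith
          _ ≤ (1 + D) ^ 6 := pow_le_pow_right₀ (by linarith) (by norm_num)
    _ = _ := by
        rw [ENNReal.ofReal_pow (by positivity), ENNReal.ofReal_mul (by norm_num), show ENNReal.ofReal 45 = 45 by norm_num]
        ring

/-- Proposition 3.1, bound (3.7): for Schwartz `w₀` and `w = ⟨·⟩²w₀`,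
`‖A[Δ(𝓜w₀)]‖_{L⁶} ≤ C ‖⟨·⟩^{−3/2}∇(𝓜w)‖_{L²} + C ‖𝓜w‖_{L²}` with a universal `C`. -/
theorem landau_laplacian_L6_bound :
    ∃ C > 0, ∀ w₀ : SchwartzMap (EuclideanSpace ℝ (Fin 3)) ℝ,
      eLpNorm (fun v => ∑ i, ∑ j,
          |LandauA (fun u => ∑ m, pd m (pd m (besselM ⇑w₀)) u) v i j|) 6 volume
        ≤ ENNReal.ofReal C *
            (eLpNorm (fun v => jap v ^ (-(3 : ℝ) / 2) *
                gradNorm (besselM fun u => jap u ^ 2 * w₀ u) v) 2 volume +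
              eLpNorm (besselM fun u => jap u ^ 2 * w₀ u) 2 volume) := by
  have hsp := sphC_pos
  refine ⟨45 * (1 + 6 * 256 * sphC ^ 4), by positivity, fun w₀ => ?_⟩
  let W : SchwartzMap E3 ℝ := SchwartzMap.smulLeftCLM ℝ (fun x : E3 => 1 + ‖x‖ ^ 2) w₀
  have hW : ∀ x, W x = jap x ^ 2 * w₀ x := by
    intro x
    rw [jap_sq]
    simp only [W]
    rw [SchwartzMap.smulLeftCLM_apply_apply (by fun_prop), smul_eq_mul]
  obtain ⟨f, hf⟩ := bessel_exists w₀
  obtain ⟨F, hF⟩ := bessel_exists W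
  have hf1 : helm f = w₀ := by
    ext x; rw [helm_apply, ← hf x]; simp_rw [pd_eq]
  have hF1 : helm F = W := by
    ext x; rw [helm_apply, ← hF x]; simp_rw [pd_eq]
  set c := 1 / (4 * Real.pi) * cB with hc
  have b1 : besselM ⇑w₀ = ⇑(c • f) := by
    funext v; rw [← hf1, bessel_helm]; rfl
  have b2 : (besselM fun u => jap u ^ 2 * w₀ u) = ⇑(c • F) := by
    have e : (fun u => jap u ^ 2 * w₀ u) = ⇑W := by funext u; rw [hW]
    funext v; rw [e, ← hF1, bessel_helm]; rfl
  rw [b1, b2]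
  apply bound_fF
  intro x
  have h1 := helm_smul c f x
  have h2 := helm_smul c F x
  rw [hf1, helm_apply] at h1
  rw [hF1, helm_apply, hW] at h2
  simp only [pd_eq]
  rw [h1, h2]
  have : jap x ≠ 0 := by have := jap_ge x; linarith
  field_simp
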